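/- arXiv:1912.11763 — 3 statements merged into one kernel-verified Lean document; each statement's English description precedes it below -/
import Mathlib

section
/- Let n ≥ 1 and for 1 ≤ k ≤ i ≤ n let a_{ik} ∈ ℚ. Set f^{a_i}_{i,n} := Σ_{k=1}^{i} a_{ik}·(∏_{ℓ=i+1}^{n}(x_k−x_ℓ))·x_k in ℝ[x_1,…,x_n] (empty product = 1) and R^{A} := ℝ[x_1,…,x_n]/(f^{a_1}_{1,n},…,f^{a_n}_{n,n}). For every j with 2 ≤ j ≤ n there exist rational numbers a'_{ik} (1 ≤ k ≤ i ≤ n−1) such that R^{A}/(x_1−x_j) is isomorphic as an ℝ-algebra to ℝ[y_1,…,y_{n−1}]/(f^{a'_1}_{1,n−1},…,f^{a'_{n−1}}_{n−1,n−1}), where f^{a'_i}_{i,n−1} := Σ_{k=1}^{i} a'_{ik}·(∏_{ℓ=i+1}^{n−1}(y_k−y_ℓ))·y_k and the isomorphism identifies y_i with the class of x_{i+1}. -/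
open MvPolynomial

noncomputable section

/-- The variable `x_k` (1-indexed) of `ℝ[x_1,…,x_n]`. -/
def xv (n : ℕ) (k : ℕ) : MvPolynomial (Fin n) ℝ :=
  if h : 1 ≤ k ∧ k ≤ n then X ⟨k - 1, by omega⟩ else 0

/-- The deformed polynomial `f^{a_i}_{i,n} = Σ_{k=1}^{i} a_{ik}·(∏_{ℓ=i+1}^{n}(x_k−x_ℓ))·x_k`. -/
def fA (n : ℕ) (a : ℕ → ℕ → ℚ) (i : ℕ) : MvPolynomial (Fin n) ℝ :=
  ∑ k ∈ Finset.Icc 1 i,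
    (a i k : ℝ) • ((∏ ℓ ∈ Finset.Icc (i + 1) n, (xv n k - xv n ℓ)) * xv n k)

/-- The ideal `(f^{a_1}_{1,n}, …, f^{a_n}_{n,n})`, so that `R^{A} = ℝ[x_1,…,x_n]/IA n a`. -/
def IA (n : ℕ) (a : ℕ → ℕ → ℚ) : Ideal (MvPolynomial (Fin n) ℝ) :=
  Ideal.span ((fun i => fA n a i) '' Set.Icc 1 n)

theorem xv_succ (m : ℕ) (t : Fin m) : xv m (t + 1) = X t := by
  have h : 1 ≤ (t : ℕ) + 1 ∧ (t : ℕ) + 1 ≤ m := by omega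
  simp [xv, h]

/-- The substitution `x_1 ↦ y_p`, `x_{k+1} ↦ y_k`. -/
def mergeFirst (m p : ℕ) : MvPolynomial (Fin (m + 1)) ℝ →ₐ[ℝ] MvPolynomial (Fin m) ℝ :=
  aeval (Fin.cases (xv m p) X)

theorem mergeFirst_xv_one (m p : ℕ) : mergeFirst m p (xv (m + 1) 1) = xv m p := by
  have h := xv_succ (m + 1) 0
  rw [Fin.val_zero, zero_add] at h
  rw [h, mergeFirst, aeval_X, Fin.cases_zero]

theorem mergeFirst_xv_succ (m p k : ℕ) (hk : 1 ≤ k) :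
    mergeFirst m p (xv (m + 1) (k + 1)) = xv m k := by
  obtain ⟨k, rfl⟩ := Nat.exists_eq_add_of_le' hk
  by_cases h : k < m
  · have h₁ := xv_succ (m + 1) (Fin.succ ⟨k, h⟩)
    have h₂ := xv_succ m ⟨k, h⟩
    rw [Fin.val_succ] at h₁
    rw [h₁, h₂, mergeFirst, aeval_X, Fin.cases_succ]
  · have h₁ : ¬ k + 1 ≤ m := by omega
    simp [xv, h₁]

theorem rename_succ_xv (m k : ℕ) (hk : 1 ≤ k) :
    rename Fin.succ (xv m k) = xv (m + 1) (k + 1) := by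
  obtain ⟨k, rfl⟩ := Nat.exists_eq_add_of_le' hk
  by_cases h : k < m
  · have h₁ := xv_succ (m + 1) (Fin.succ ⟨k, h⟩)
    have h₂ := xv_succ m ⟨k, h⟩
    rw [Fin.val_succ] at h₁
    rw [h₁, h₂, rename_X]
  · have h₁ : ¬ k + 1 ≤ m := by omega
    simp [xv, h₁]

theorem mergeFirst_rename_succ (m p : ℕ) (q : MvPolynomial (Fin m) ℝ) :
    mergeFirst m p (rename Fin.succ q) = q := by
  have h : (mergeFirst m p).comp (rename Fin.succ) = AlgHom.id ℝ _ := by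
    ext t
    simp [mergeFirst]
  exact DFunLike.congr_fun h q

/-- The coefficients obtained by adding the first column to the column `p + 1`, and then
deleting the first row and the first column. -/
def mergeCoeff (a : ℕ → ℕ → ℚ) (p i k : ℕ) : ℚ :=
  a (i + 1) (k + 1) + if k = p then a (i + 1) 1 else 0

theorem mergeFirst_fA (m p : ℕ) (hp : 1 ≤ p) (hpm : p ≤ m) (a : ℕ → ℕ → ℚ) (i : ℕ) :
    mergeFirst m p (fA (m + 1) a (i + 1)) = fA m (mergeCoeff a p) i := by
  have hsum : ∀ g : ℕ → MvPolynomial (Fin m) ℝ,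
      ∑ k ∈ Finset.Icc 1 (i + 1), g k = g 1 + ∑ k ∈ Finset.Icc 1 i, g (k + 1) := by
    intro g
    rw [← Finset.add_sum_Ioc_eq_sum_Icc (by omega), ← Finset.Icc_add_one_left_eq_Ioc,
      ← Finset.map_add_right_Icc, Finset.sum_map]
    rfl
  have hprod : ∀ g : ℕ → MvPolynomial (Fin m) ℝ,
      ∏ ℓ ∈ Finset.Icc (i + 1 + 1) (m + 1), g ℓ = ∏ ℓ ∈ Finset.Icc (i + 1) m, g (ℓ + 1) := by
    intro g
    rw [← Finset.map_add_right_Icc, Finset.prod_map]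
    rfl
  set P : ℕ → MvPolynomial (Fin m) ℝ :=
    fun k => (∏ ℓ ∈ Finset.Icc (i + 1) m, (xv m k - xv m ℓ)) * xv m k with hP
  have hvars : ∀ ℓ ∈ Finset.Icc (i + 1) m, mergeFirst m p (xv (m + 1) (ℓ + 1)) = xv m ℓ :=
    fun ℓ hℓ => mergeFirst_xv_succ m p ℓ (by rw [Finset.mem_Icc] at hℓ; omega)
  have hterm : ∀ k q, mergeFirst m p (xv (m + 1) k) = xv m q →
      mergeFirst m p ((∏ ℓ ∈ Finset.Icc (i + 1 + 1) (m + 1), (xv (m + 1) k - xv (m + 1) ℓ))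
        * xv (m + 1) k) = P q := by
    intro k q h
    rw [map_mul, map_prod, hprod, h, hP]
    congr 1
    refine Finset.prod_congr rfl fun ℓ hℓ => ?_
    rw [map_sub, h, hvars ℓ hℓ]
  have hlast : ∑ k ∈ Finset.Icc 1 i, (if k = p then (a (i + 1) 1 : ℝ) • P k else 0)
      = (a (i + 1) 1 : ℝ) • P p := by
    rw [Finset.sum_ite_eq']
    split_ifs with h
    · rfl
    · have hmem : p ∈ Finset.Icc (i + 1) m := by
        rw [Finset.mem_Icc] at h ⊢
        omega
      rw [hP]
      simp only
      rw [Finset.prod_eq_zero hmem (sub_self _), zero_mul, smul_zero]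
  unfold fA
  rw [map_sum, hsum, map_smul, hterm 1 p (mergeFirst_xv_one m p), ← hlast,
    ← Finset.sum_add_distrib]
  refine Finset.sum_congr rfl fun k hk => ?_
  rw [map_smul, hterm (k + 1) k (mergeFirst_xv_succ m p k (Finset.mem_Icc.1 hk).1), mergeCoeff]
  split_ifs
  · rw [Rat.cast_add, add_smul, add_comm]
  · rw [add_zero, zero_add]

theorem mk_rename_mergeFirst (m p : ℕ) (hp : 1 ≤ p)
    (J : Ideal (MvPolynomial (Fin (m + 1)) ℝ)) (hJ : xv (m + 1) 1 - xv (m + 1) (p + 1) ∈ J)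
    (q : MvPolynomial (Fin (m + 1)) ℝ) :
    Ideal.Quotient.mk J (rename Fin.succ (mergeFirst m p q)) = Ideal.Quotient.mk J q := by
  have h : (Ideal.Quotient.mkₐ ℝ J).comp ((rename Fin.succ).comp (mergeFirst m p))
      = Ideal.Quotient.mkₐ ℝ J := by
    ext t
    refine Fin.cases ?_ (fun t => ?_) t
    · have h₁ := xv_succ (m + 1) 0
      rw [Fin.val_zero, zero_add] at h₁
      rw [← h₁]
      simp only [AlgHom.comp_apply, Ideal.Quotient.mkₐ_eq_mk]
      rw [mergeFirst_xv_one, rename_succ_xv m p hp]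
      exact (Ideal.Quotient.eq.2 hJ).symm
    · simp [mergeFirst]
  exact DFunLike.congr_fun h q

/-- **Lemma 5.3.** For `2 ≤ j ≤ n`, the quotient `R^{A}/(x_1 − x_j)` is isomorphic, as an
ℝ-algebra, to a ring of the same shape in `n−1` variables, identifying `y_i` with the class
of `x_{i+1}`. -/
theorem stmt_1 (n : ℕ) (hn : 1 ≤ n) (a : ℕ → ℕ → ℚ) (j : ℕ) (hj2 : 2 ≤ j) (hjn : j ≤ n) :
    ∃ a' : ℕ → ℕ → ℚ,
      ∃ e : (MvPolynomial (Fin n) ℝ ⧸ (IA n a ⊔ Ideal.span {xv n 1 - xv n j})) ≃ₐ[ℝ]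
          (MvPolynomial (Fin (n - 1)) ℝ ⧸ IA (n - 1) a'),
        ∀ i ∈ Finset.Icc 1 (n - 1),
          e (Ideal.Quotient.mk (IA n a ⊔ Ideal.span {xv n 1 - xv n j}) (xv n (i + 1))) =
            Ideal.Quotient.mk (IA (n - 1) a') (xv (n - 1) i) := by
  obtain ⟨m, rfl⟩ := Nat.exists_eq_add_of_le' hn
  obtain ⟨p, rfl⟩ := Nat.exists_eq_add_of_le' (show 1 ≤ j by omega)
  have hp : 1 ≤ p := by omega
  have hpm : p ≤ m := by omega
  rw [Nat.add_sub_cancel]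
  set J := IA (m + 1) a ⊔ Ideal.span {xv (m + 1) 1 - xv (m + 1) (p + 1)} with hJdef
  set I := IA m (mergeCoeff a p) with hIdef
  have hJ : xv (m + 1) 1 - xv (m + 1) (p + 1) ∈ J :=
    Ideal.mem_sup_right (Ideal.mem_span_singleton_self _)
  have hfwd : J ≤ I.comap (mergeFirst m p) := by
    refine sup_le (Ideal.span_le.2 ?_) (Ideal.span_le.2 ?_)
    · rintro _ ⟨i, hi, rfl⟩
      obtain ⟨i, rfl⟩ := Nat.exists_eq_add_of_le' hi.1
      rw [SetLike.mem_coe, Ideal.mem_comap, mergeFirst_fA m p hp hpm]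
      rcases Nat.eq_zero_or_pos i with rfl | hi₀
      · simp [fA]
      · exact Ideal.subset_span ⟨i, ⟨hi₀, Nat.le_of_succ_le_succ hi.2⟩, rfl⟩
    · rw [Set.singleton_subset_iff, SetLike.mem_coe, Ideal.mem_comap, map_sub,
        mergeFirst_xv_one, mergeFirst_xv_succ m p p hp, sub_self]
      exact I.zero_mem
  have hbwd : I ≤ J.comap (rename Fin.succ : _ →ₐ[ℝ] MvPolynomial (Fin (m + 1)) ℝ) := by
    refine Ideal.span_le.2 ?_
    rintro _ ⟨i, hi, rfl⟩
    rw [SetLike.mem_coe, Ideal.mem_comap, ← Ideal.Quotient.eq_zero_iff_mem]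
    simp only
    rw [← mergeFirst_fA m p hp hpm, mk_rename_mergeFirst m p hp J hJ,
      Ideal.Quotient.eq_zero_iff_mem]
    exact Ideal.mem_sup_left
      (Ideal.subset_span ⟨i + 1, ⟨Nat.le_add_left 1 i, Nat.succ_le_succ hi.2⟩, rfl⟩)
  refine ⟨mergeCoeff a p, AlgEquiv.ofAlgHom (Ideal.quotientMapₐ I (mergeFirst m p) hfwd)
    (Ideal.quotientMapₐ J (rename Fin.succ) hbwd) ?_ ?_, ?_⟩
  · refine AlgHom.ext fun q => ?_
    obtain ⟨q, rfl⟩ := Ideal.Quotient.mk_surjective q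
    exact congrArg (Ideal.Quotient.mk I) (mergeFirst_rename_succ m p q)
  · refine AlgHom.ext fun q => ?_
    obtain ⟨q, rfl⟩ := Ideal.Quotient.mk_surjective q
    exact mk_rename_mergeFirst m p hp J hJ q
  · intro i hi
    exact congrArg (Ideal.Quotient.mk I) (mergeFirst_xv_succ m p i (Finset.mem_Icc.1 hi).1)
end
end

section
/- Let n ≥ 1, let a_{ik} ∈ ℚ for 1 ≤ k ≤ i ≤ n, set f^{a_i}_{i,n} := Σ_{k=1}^{i} a_{ik}·(∏_{ℓ=i+1}^{n}(x_k−x_ℓ))·x_k and R^{A} := ℝ[x_1,…,x_n]/(f^{a_1}_{1,n},…,f^{a_n}_{n,n}), and assume R^{A} is Artinian (i.e., finite dimensional as an ℝ-vector space). Fix for each i = 1,…,n−1 a permutation w^{(i)} of the set {i+1, i+2, …, n}. Then the classes ∏_{i=1}^{n−1} α_{i,w^{(i)}(n)}·α_{i,w^{(i)}(n−1)}···α_{i,w^{(i)}(n−m_i+1)}, indexed by tuples (m_1,…,m_{n−1}) with 0 ≤ m_i ≤ n−i (an empty product being 1), form a basis of R^{A} as an ℝ-vector space. -/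
open MvPolynomial

noncomputable section

/-- The class of `∏_{i=1}^{n-1} α_{i,w⁽ⁱ⁾(n)}·α_{i,w⁽ⁱ⁾(n−1)}···α_{i,w⁽ⁱ⁾(n−m_i+1)}`
in `R^{A}`, where `α_{i,j} = x_i − x_j`. -/
def basA (n : ℕ) (a : ℕ → ℕ → ℚ) (w : ℕ → Equiv.Perm ℕ)
    (m : (i : Fin (n - 1)) → Fin (n - (i.val + 1) + 1)) :
    MvPolynomial (Fin n) ℝ ⧸ IA n a :=
  Ideal.Quotient.mk (IA n a)
    (∏ i : Fin (n - 1), ∏ t ∈ Finset.range (m i : ℕ),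
      (xv n (i.val + 1) - xv n (w (i.val + 1) (n - t))))

section CompleteIntersection

variable {σ K : Type*} [Field K]

lemma homogeneousComponent_mul_of_isHomogeneous {p q : MvPolynomial σ K} {e : ℕ}
    (hq : q.IsHomogeneous e) (D : ℕ) :
    homogeneousComponent D (p * q) =
      if e ≤ D then homogeneousComponent (D - e) p * q else 0 := by
  let _ : GradedAlgebra (homogeneousSubmodule σ K) := MvPolynomial.gradedAlgebra
  have h := DirectSum.coe_decompose_mul_of_right_mem (homogeneousSubmodule σ K)
    (a := p) (b := q) (i := e) D hq
  simp only [← decomposition.decompose'_apply]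
  exact h

variable [Fintype σ] [DecidableEq σ]

/-- Exponent vectors `β` of weighted degree `∑ i, d i * β i` at most `D`. -/
def weightedSimplex (d : σ → ℕ) (D : ℕ) : Finset (σ → ℕ) :=
  (Fintype.piFinset fun _ => Finset.range (D + 1)).filter fun β => ∑ i, d i * β i ≤ D

lemma mem_weightedSimplex {d : σ → ℕ} (hd : ∀ i, 0 < d i) {D : ℕ} {β : σ → ℕ} :
    β ∈ weightedSimplex d D ↔ ∑ i, d i * β i ≤ D := by
  simp only [weightedSimplex, Finset.mem_filter, Fintype.mem_piFinset, Finset.mem_range,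
    and_iff_right_iff_imp]
  intro h i
  have h1 : d i * β i ≤ ∑ i, d i * β i :=
    Finset.single_le_sum (f := fun i => d i * β i) (fun _ _ => Nat.zero_le _) (Finset.mem_univ i)
  have h2 := Nat.le_mul_of_pos_left (β i) (hd i)
  omega

lemma mem_weightedSimplex_one {D : ℕ} {β : σ → ℕ} :
    β ∈ weightedSimplex (1 : σ → ℕ) D ↔ ∑ i, β i ≤ D := by
  simp [mem_weightedSimplex]

lemma card_weightedSimplex_le (d : σ → ℕ) (D : ℕ) :
    (weightedSimplex d D).card ≤ (D + 1) ^ Fintype.card σ := by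
  refine (Finset.card_filter_le _ _).trans ?_
  simp [Fintype.card_piFinset]

/-- Division with remainder by `d` injects `weightedSimplex d D × ∏ i, Fin (d i)` into a
slightly larger standard simplex. -/
lemma prod_mul_card_weightedSimplex_le {d : σ → ℕ} (hd : ∀ i, 0 < d i) (D : ℕ) :
    (∏ i, d i) * (weightedSimplex d D).card ≤
      (weightedSimplex (1 : σ → ℕ) (D + ∑ i, d i)).card := by
  have hcard : (∏ i, d i) * (weightedSimplex d D).card =
      ((Fintype.piFinset fun i => Finset.range (d i)) ×ˢ weightedSimplex d D).card := by
    simp [Finset.card_product, Fintype.card_piFinset]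
  rw [hcard]
  refine Finset.card_le_card_of_injOn (fun p i => p.1 i + d i * p.2 i) ?_ ?_
  · rintro ⟨r, β⟩ h
    simp only [Finset.coe_product, Set.mem_prod, Finset.mem_coe, Fintype.mem_piFinset,
      Finset.mem_range, mem_weightedSimplex hd] at h
    rw [Finset.mem_coe, mem_weightedSimplex_one]
    simp only [Finset.sum_add_distrib]
    have := Finset.sum_le_sum fun i (_ : i ∈ Finset.univ) => (h.1 i).le
    omega
  · rintro ⟨r, β⟩ h ⟨r', β'⟩ h' heq
    simp only [Finset.coe_product, Set.mem_prod, Finset.mem_coe, Fintype.mem_piFinset,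
      Finset.mem_range] at h h'
    have hr : ∀ i, r i = r' i := fun i => by
      have := congrArg (· % d i) (congrFun heq i)
      simpa [Nat.mod_eq_of_lt (h.1 i), Nat.mod_eq_of_lt (h'.1 i)] using this
    have hβ : ∀ i, β i = β' i := fun i => by
      have := congrFun heq i
      simp only [hr i, add_right_inj] at this
      exact Nat.eq_of_mul_eq_mul_left (hd i) this
    simp [funext hr, funext hβ]

/-- Graded Nakayama: homogeneous generators of the quotient generate the polynomial ring as a
module over the subalgebra generated by the relations, with control of the degree. -/
lemma mem_span_mul_prod_pow {ι : Type*} [Fintype ι] {b : ι → MvPolynomial σ K} {e : ι → ℕ}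
    (hb : ∀ j, (b j).IsHomogeneous (e j)) {f : σ → MvPolynomial σ K} {d : σ → ℕ}
    (hd : ∀ i, 0 < d i) (hf : ∀ i, (f i).IsHomogeneous (d i))
    (hspan : ∀ p, ∃ c : ι → K, p - ∑ j, c j • b j ∈ Ideal.span (Set.range f))
    (D : ℕ) {p : MvPolynomial σ K} (hp : p.IsHomogeneous D) :
    p ∈ Submodule.span K ((fun x : ι × (σ → ℕ) => b x.1 * ∏ i, f i ^ x.2 i) ''
      (Set.univ ×ˢ (weightedSimplex d D : Set (σ → ℕ)))) := by
  induction D using Nat.strong_induction_on generalizing p with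
  | _ D ih =>
  obtain ⟨c, hc⟩ := hspan p
  obtain ⟨g, hg⟩ := (Ideal.mem_span_range_iff_exists_fun).1 hc
  have hp' : p = ∑ j, c j • homogeneousComponent D (b j) +
      ∑ i, homogeneousComponent D (g i * f i) := by
    have h : p = ∑ j, c j • b j + ∑ i, g i * f i := by rw [hg]; ring
    conv_lhs => rw [← homogeneousComponent_eq_self hp, h]
    simp [map_sum]
  rw [hp']
  refine add_mem (sum_mem fun j _ => Submodule.smul_mem _ _ ?_) (sum_mem fun i _ => ?_)
  · rw [homogeneousComponent_of_mem (hb j)]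
    split_ifs
    · refine Submodule.subset_span ⟨(j, 0), ⟨trivial, ?_⟩, by simp⟩
      simp [mem_weightedSimplex hd]
    · exact zero_mem _
  · rw [homogeneousComponent_mul_of_isHomogeneous (hf i)]
    split_ifs with hle
    · have h := ih (D - d i) (by have := hd i; omega)
        (homogeneousComponent_isHomogeneous (D - d i) (g i))
      have h' := Submodule.mem_map_of_mem (f := LinearMap.mulRight K (f i)) h
      rw [Submodule.map_span, LinearMap.mulRight_apply] at h'
      refine Submodule.span_mono ?_ h'
      rintro _ ⟨_, ⟨⟨j, β⟩, ⟨-, hβ⟩, rfl⟩, rfl⟩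
      refine ⟨(j, β + Pi.single i 1), ⟨trivial, ?_⟩, ?_⟩
      · simp only [Finset.mem_coe, mem_weightedSimplex hd] at hβ ⊢
        simp only [Pi.add_apply, mul_add, Finset.sum_add_distrib]
        simp only [Pi.single_apply, mul_ite, mul_one, mul_zero, Finset.sum_ite_eq',
          Finset.mem_univ, if_true]
        omega
      · simp only [Pi.add_apply, pow_add, Finset.prod_mul_distrib, LinearMap.mulRight_apply,
          Pi.single_apply, pow_ite, pow_one, pow_zero, Finset.prod_ite_eq', Finset.mem_univ,
          if_true, mul_assoc]
    · exact zero_mem _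

lemma card_weightedSimplex_one_le {ι : Type*} [Fintype ι] {b : ι → MvPolynomial σ K} {e : ι → ℕ}
    (hb : ∀ j, (b j).IsHomogeneous (e j)) {f : σ → MvPolynomial σ K} {d : σ → ℕ}
    (hd : ∀ i, 0 < d i) (hf : ∀ i, (f i).IsHomogeneous (d i))
    (hspan : ∀ p, ∃ c : ι → K, p - ∑ j, c j • b j ∈ Ideal.span (Set.range f)) (D : ℕ) :
    (weightedSimplex (1 : σ → ℕ) D).card ≤ Fintype.card ι * (weightedSimplex d D).card := by
  classical
  let s : Finset (MvPolynomial σ K) := (Finset.univ ×ˢ weightedSimplex d D).image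
    fun x : ι × (σ → ℕ) => b x.1 * ∏ i, f i ^ x.2 i
  have hs : s.card ≤ Fintype.card ι * (weightedSimplex d D).card :=
    Finset.card_image_le.trans_eq (by simp [Finset.card_product])
  let v : weightedSimplex (1 : σ → ℕ) D → MvPolynomial σ K :=
    fun γ => monomial (Finsupp.equivFunOnFinite.symm γ.1) 1
  have hv : LinearIndependent K v := by
    have h := (basisMonomials σ K).linearIndependent.comp
      (fun γ : weightedSimplex (1 : σ → ℕ) D => Finsupp.equivFunOnFinite.symm γ.1)
      (Finsupp.equivFunOnFinite.symm.injective.comp Subtype.val_injective)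
    simpa [Function.comp_def, v] using h
  refine le_trans ?_ hs
  have key := linearIndependent_le_span' v hv (s : Set (MvPolynomial σ K)) ?_
  · simpa using key
  · rintro _ ⟨⟨γ, hγ⟩, rfl⟩
    have hγD := mem_weightedSimplex_one.1 hγ
    have hhom : (v ⟨γ, hγ⟩).IsHomogeneous (∑ i, γ i) := by
      refine isHomogeneous_monomial _ ?_
      rw [Finsupp.degree_eq_sum]
      rfl
    refine Submodule.span_mono ?_ (mem_span_mul_prod_pow hb hd hf hspan _ hhom)
    rintro _ ⟨⟨j, β⟩, ⟨-, hβ⟩, rfl⟩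
    simp only [Finset.mem_coe, mem_weightedSimplex hd] at hβ
    simp only [s, Finset.coe_image, Finset.coe_product]
    refine ⟨(j, β), ⟨by simp, ?_⟩, rfl⟩
    simp only [Finset.mem_coe, mem_weightedSimplex hd]
    omega

end CompleteIntersection

lemma le_of_pow_le_pow_mul_polynomial {P N C r : ℕ}
    (h : ∀ k : ℕ, P ^ k ≤ N ^ k * (C * k + 1) ^ r) : P ≤ N := by
  by_contra! hlt
  rcases Nat.eq_zero_or_pos N with rfl | hN
  · have := h 1
    simp at this
    omega
  have hN' : (0 : ℝ) < N := by exact_mod_cast hN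
  have hr : (1 : ℝ) < P / N := by rw [one_lt_div hN']; exact_mod_cast hlt
  have hlim := (tendsto_pow_const_div_const_pow_of_one_lt r hr).const_mul (((C : ℝ) + 1) ^ r)
  rw [mul_zero] at hlim
  obtain ⟨k, hk, hk1⟩ :=
    ((hlim.eventually_lt_const one_pos).and (Filter.eventually_ge_atTop 1)).exists
  have hpos : (0 : ℝ) < (P / N : ℝ) ^ k := pow_pos (one_pos.trans hr) k
  rw [← mul_div_assoc, div_lt_one hpos, ← mul_pow, div_pow, lt_div_iff₀ (pow_pos hN' k)] at hk
  have h1 : (P : ℝ) ^ k ≤ N ^ k * (C * k + 1) ^ r := by exact_mod_cast h k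
  have hk1' : (1 : ℝ) ≤ k := by exact_mod_cast hk1
  have h2 : ((C : ℝ) * k + 1) ^ r ≤ ((C + 1) * k) ^ r :=
    pow_le_pow_left₀ (by positivity) (by linarith) r
  nlinarith [mul_le_mul_of_nonneg_left h2 (pow_pos hN' k).le]

/-- A finite dimensional quotient of a polynomial ring in `n` variables by `n` homogeneous
polynomials of positive degrees has dimension at least the product of the degrees. -/
theorem prod_degree_le_finrank_quotient {σ K : Type*} [Fintype σ] [Field K]
    {f : σ → MvPolynomial σ K} {d : σ → ℕ}
    (hd : ∀ i, 0 < d i) (hf : ∀ i, (f i).IsHomogeneous (d i))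
    [FiniteDimensional K (MvPolynomial σ K ⧸ Ideal.span (Set.range f))] :
    ∏ i, d i ≤ Module.finrank K (MvPolynomial σ K ⧸ Ideal.span (Set.range f)) := by
  classical
  set I := Ideal.span (Set.range f)
  let q : MvPolynomial σ K →ₗ[K] MvPolynomial σ K ⧸ I := (Ideal.Quotient.mkₐ K I).toLinearMap
  have hq : Function.Surjective q := Ideal.Quotient.mk_surjective
  let s : Set (MvPolynomial σ K ⧸ I) := Set.range fun m : σ →₀ ℕ => q (monomial m 1)
  have hs : Submodule.span K s = ⊤ := by
    have h1 : s = q '' Set.range (basisMonomials σ K) := by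
      rw [← Set.range_comp]; simp [s, Function.comp_def]
    rw [h1, ← Submodule.map_span, Module.Basis.span_eq, Submodule.map_top,
      LinearMap.range_eq_top.2 hq]
  set N := Module.finrank K (Submodule.span K s) with hN
  obtain ⟨v, hvs, hv, -⟩ := Submodule.exists_fun_fin_finrank_span_eq K s
  choose m hm using hvs
  rw [← finrank_top K (MvPolynomial σ K ⧸ I), ← hs, ← hN]
  let b : Fin N → MvPolynomial σ K := fun j => monomial (m j) 1
  have hspan : ∀ p, ∃ c : Fin N → K, p - ∑ j, c j • b j ∈ I := fun p => by
    have hp : q p ∈ Submodule.span K (Set.range v) := by rw [hv, hs]; trivial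
    obtain ⟨c, hc⟩ := (Submodule.mem_span_range_iff_exists_fun K).1 hp
    refine ⟨c, Ideal.Quotient.eq.1 ?_⟩
    change q p = q _
    rw [← hc, map_sum]
    exact Finset.sum_congr rfl fun j _ => by rw [map_smul, ← hm j]
  have hstep : ∀ D, (∏ i, d i) * (weightedSimplex (1 : σ → ℕ) D).card ≤
      N * (weightedSimplex (1 : σ → ℕ) (D + ∑ i, d i)).card := fun D => by
    have h1 := card_weightedSimplex_one_le (fun j => isHomogeneous_monomial (1 : K) rfl)
      hd hf hspan D
    have h2 := prod_mul_card_weightedSimplex_le hd D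
    rw [Fintype.card_fin] at h1
    calc _ ≤ (∏ i, d i) * (N * (weightedSimplex d D).card) := Nat.mul_le_mul_left _ h1
      _ = N * ((∏ i, d i) * (weightedSimplex d D).card) := by ring
      _ ≤ _ := Nat.mul_le_mul_left _ h2
  refine le_of_pow_le_pow_mul_polynomial (C := ∑ i, d i) (r := Fintype.card σ) fun k => ?_
  refine le_trans (b := N ^ k * (weightedSimplex (1 : σ → ℕ) ((∑ i, d i) * k)).card) ?_
    (Nat.mul_le_mul_left _ (card_weightedSimplex_le _ _))
  induction k with
  | zero =>
    rw [pow_zero, pow_zero, one_mul]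
    exact Finset.card_pos.2 ⟨0, by simp [mem_weightedSimplex]⟩
  | succ k ih =>
    calc (∏ i, d i) ^ (k + 1) = (∏ i, d i) * (∏ i, d i) ^ k := by ring
      _ ≤ (∏ i, d i) * (N ^ k * (weightedSimplex (1 : σ → ℕ) ((∑ i, d i) * k)).card) :=
        Nat.mul_le_mul_left _ ih
      _ = N ^ k * ((∏ i, d i) * (weightedSimplex (1 : σ → ℕ) ((∑ i, d i) * k)).card) := by ring
      _ ≤ N ^ k * (N * (weightedSimplex (1 : σ → ℕ) ((∑ i, d i) * k + ∑ i, d i)).card) :=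
        Nat.mul_le_mul_left _ (hstep _)
      _ = _ := by rw [mul_add_one, pow_succ, mul_assoc]

section Spanning

variable {n : ℕ}

lemma isHomogeneous_xv (n k : ℕ) : (xv n k).IsHomogeneous 1 := by
  unfold xv
  split_ifs
  · exact isHomogeneous_X _ _
  · exact isHomogeneous_zero _ _ _

/-- The summand `(∏_{ℓ=i+1}^{n}(y−x_ℓ))·y` of the `i`-th relation, as a function of `y`. -/
def relTerm (n i : ℕ) (y : MvPolynomial (Fin n) ℝ) : MvPolynomial (Fin n) ℝ :=
  (∏ ℓ ∈ Finset.Icc (i + 1) n, (y - xv n ℓ)) * y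

/-- The relation `Σ_{k=s}^{i} a_{ik}·(∏_{ℓ=i+1}^{n}(x_k−x_ℓ))·x_k` in the variables
`x_s,…,x_n`, with real coefficients. -/
def truncRel (n s : ℕ) (a : ℕ → ℕ → ℝ) (i : ℕ) : MvPolynomial (Fin n) ℝ :=
  ∑ k ∈ Finset.Icc s i, a i k • relTerm n i (xv n k)

lemma truncRel_one (a : ℕ → ℕ → ℚ) (i : ℕ) :
    truncRel n 1 (fun i k => (a i k : ℝ)) i = fA n a i := rfl

lemma isHomogeneous_truncRel {s i : ℕ} (a : ℕ → ℕ → ℝ) :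
    (truncRel n s a i).IsHomogeneous (n - i + 1) := by
  refine IsHomogeneous.sum _ _ _ fun k _ => ?_
  rw [smul_eq_C_mul]
  have hprod := IsHomogeneous.prod (Finset.Icc (i + 1) n) (fun ℓ => xv n k - xv n ℓ) (fun _ => 1)
    fun ℓ _ => (isHomogeneous_xv n k).sub (isHomogeneous_xv n ℓ)
  have h := (isHomogeneous_C (Fin n) (a i k)).mul (hprod.mul (isHomogeneous_xv n k))
  have hdeg : 0 + (∑ _ℓ ∈ Finset.Icc (i + 1) n, 1 + 1) = n - i + 1 := by simp
  rwa [hdeg] at h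

lemma truncRel_eq_add {s i : ℕ} (h : s ≤ i) (a : ℕ → ℕ → ℝ) :
    truncRel n s a i = a i s • relTerm n i (xv n s) + truncRel n (s + 1) a i := by
  rw [truncRel, ← Finset.insert_Icc_add_one_left_eq_Icc h, Finset.sum_insert (by simp), truncRel]

lemma truncRel_self (s : ℕ) (a : ℕ → ℕ → ℝ) :
    truncRel n s a s = a s s • relTerm n s (xv n s) := by
  simp [truncRel]

lemma sub_dvd_relTerm_sub (i : ℕ) (y z : MvPolynomial (Fin n) ℝ) :
    y - z ∣ relTerm n i y - relTerm n i z := by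
  have h := Polynomial.sub_dvd_eval_sub y z
    ((∏ ℓ ∈ Finset.Icc (i + 1) n, (Polynomial.X - Polynomial.C (xv n ℓ))) * Polynomial.X)
  simpa [relTerm, Polynomial.eval_prod] using h

lemma sub_dvd_relTerm {i ℓ : ℕ} (hℓ : ℓ ∈ Finset.Icc (i + 1) n) (y : MvPolynomial (Fin n) ℝ) :
    y - xv n ℓ ∣ relTerm n i y :=
  (Finset.dvd_prod_of_mem (fun ℓ => y - xv n ℓ) hℓ).mul_right _

/-- The linear factors `x_s` and `x_s − x_ℓ`, `s < ℓ ≤ n`, of the first relation. -/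
def IsRelFactor (n s : ℕ) (α : MvPolynomial (Fin n) ℝ) : Prop :=
  α = xv n s ∨ ∃ ℓ ∈ Finset.Icc (s + 1) n, α = xv n s - xv n ℓ

lemma IsRelFactor.isHomogeneous {s : ℕ} {α : MvPolynomial (Fin n) ℝ} (h : IsRelFactor n s α) :
    α.IsHomogeneous 1 := by
  obtain rfl | ⟨ℓ, -, rfl⟩ := h
  · exact isHomogeneous_xv n s
  · exact (isHomogeneous_xv n s).sub (isHomogeneous_xv n ℓ)

lemma IsRelFactor.dvd_truncRel_self {s : ℕ} {α : MvPolynomial (Fin n) ℝ}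
    (h : IsRelFactor n s α) (a : ℕ → ℕ → ℝ) : α ∣ truncRel n s a s := by
  rw [truncRel_self, smul_eq_C_mul]
  refine Dvd.dvd.mul_left ?_ _
  obtain rfl | ⟨ℓ, hℓ, rfl⟩ := h
  · exact Dvd.intro_left _ rfl
  · exact sub_dvd_relTerm hℓ _

/-- Modulo a linear factor of the first relation, the remaining relations are again relations
of the same shape in one variable less. -/
lemma IsRelFactor.exists_dvd_truncRel_sub {s : ℕ} {α : MvPolynomial (Fin n) ℝ}
    (h : IsRelFactor n s α) (a : ℕ → ℕ → ℝ) :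
    ∃ a' : ℕ → ℕ → ℝ, ∀ i, s < i → α ∣ truncRel n s a i - truncRel n (s + 1) a' i := by
  obtain rfl | ⟨ℓ, hℓ, rfl⟩ := h
  · refine ⟨a, fun i hi => ?_⟩
    rw [truncRel_eq_add hi.le, add_sub_cancel_right, smul_eq_C_mul]
    exact (Dvd.intro_left _ rfl : xv n s ∣ relTerm n i (xv n s)).mul_left _
  · refine ⟨fun i k => a i k + if k = ℓ then a i s else 0, fun i hi => ?_⟩
    rw [truncRel_eq_add hi.le]
    have hsum : truncRel n (s + 1) (fun i k => a i k + if k = ℓ then a i s else 0) i =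
        truncRel n (s + 1) a i + if ℓ ≤ i then a i s • relTerm n i (xv n ℓ) else 0 := by
      simp only [truncRel, add_smul, Finset.sum_add_distrib, ite_smul, zero_smul,
        Finset.sum_ite_eq', Finset.mem_Icc, (Finset.mem_Icc.1 hℓ).1, true_and]
    rw [hsum]
    split_ifs with hle
    · rw [add_comm, add_sub_add_left_eq_sub, ← smul_sub, smul_eq_C_mul]
      exact (sub_dvd_relTerm_sub i _ _).mul_left _
    · rw [add_zero, add_sub_cancel_right, smul_eq_C_mul]
      refine (sub_dvd_relTerm (Finset.mem_Icc.2 ⟨?_, (Finset.mem_Icc.1 hℓ).2⟩) _).mul_left _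
      omega

/-- The generators of the partially specialized ideal: linear forms `L i` for `i < s`, and
relations in the variables `x_s,…,x_n` for `i ≥ s`. -/
def specGen (n s : ℕ) (L : ℕ → MvPolynomial (Fin n) ℝ) (a : ℕ → ℕ → ℝ) (i : ℕ) :
    MvPolynomial (Fin n) ℝ :=
  if i < s then L i else truncRel n s a i

/-- The partially specialized ideal generated by `specGen`. -/
def specIdeal (n s : ℕ) (L : ℕ → MvPolynomial (Fin n) ℝ) (a : ℕ → ℕ → ℝ) :
    Ideal (MvPolynomial (Fin n) ℝ) :=
  Ideal.span (specGen n s L a '' Set.Icc 1 n)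

lemma specGen_mem {s i : ℕ} {L : ℕ → MvPolynomial (Fin n) ℝ} {a : ℕ → ℕ → ℝ}
    (hi : 1 ≤ i) (hin : i ≤ n) : specGen n s L a i ∈ specIdeal n s L a :=
  Ideal.subset_span ⟨i, ⟨hi, hin⟩, rfl⟩

lemma specIdeal_one (L : ℕ → MvPolynomial (Fin n) ℝ) (a : ℕ → ℕ → ℚ) :
    specIdeal n 1 L (fun i k => (a i k : ℝ)) = IA n a := by
  refine congrArg Ideal.span (Set.image_congr fun i hi => ?_)
  rw [specGen, if_neg (by have := hi.1; omega), truncRel_one]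

lemma prod_degree_le_finrank_quotient_span_image {g : ℕ → MvPolynomial (Fin n) ℝ} {d : ℕ → ℕ}
    (hd : ∀ i, 0 < d i) (hg : ∀ i ∈ Set.Icc 1 n, (g i).IsHomogeneous (d i))
    (hfin : FiniteDimensional ℝ (MvPolynomial (Fin n) ℝ ⧸ Ideal.span (g '' Set.Icc 1 n))) :
    ∏ i : Fin n, d (i + 1) ≤
      Module.finrank ℝ (MvPolynomial (Fin n) ℝ ⧸ Ideal.span (g '' Set.Icc 1 n)) := by
  have himage : g '' Set.Icc 1 n = Set.range fun i : Fin n => g (i + 1) := by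
    ext p
    constructor
    · rintro ⟨i, ⟨h1, h2⟩, rfl⟩
      exact ⟨⟨i - 1, by omega⟩, by simp [Nat.sub_add_cancel h1]⟩
    · rintro ⟨i, rfl⟩
      exact ⟨i + 1, ⟨by omega, i.2⟩, rfl⟩
  rw [himage] at hfin ⊢
  exact prod_degree_le_finrank_quotient (fun i : Fin n => hd (i + 1))
    fun i => hg _ ⟨by omega, i.2⟩

lemma leadingCoeff_ne_zero_of_finiteDimensional {s : ℕ} (hs : 1 ≤ s) (hsn : s ≤ n)
    {L : ℕ → MvPolynomial (Fin n) ℝ} (hL : ∀ i < s, IsRelFactor n i (L i)) {a : ℕ → ℕ → ℝ}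
    (hfin : FiniteDimensional ℝ (MvPolynomial (Fin n) ℝ ⧸ specIdeal n s L a)) :
    a s s ≠ 0 := by
  intro h0
  set N := Module.finrank ℝ (MvPolynomial (Fin n) ℝ ⧸ specIdeal n s L a)
  let d : ℕ → ℕ := fun i => if i = s then N + 1 else if i < s then 1 else n - i + 1
  have hd : ∀ i, 0 < d i := fun i => by
    simp only [d]
    split_ifs <;> omega
  have hle := prod_degree_le_finrank_quotient_span_image (g := specGen n s L a) hd ?_ hfin
  · have hdvd := Finset.dvd_prod_of_mem (fun i : Fin n => d (i + 1))
      (Finset.mem_univ (⟨s - 1, by omega⟩ : Fin n))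
    have := Nat.le_of_dvd (Finset.prod_pos fun i _ => hd _) hdvd
    simp only [Nat.sub_add_cancel hs, d, if_true] at this
    change _ ≤ N at hle
    simp only [d] at hle
    omega
  · intro i _
    simp only [specGen, d]
    split_ifs with h1 h2 h2
    · omega
    · exact (hL i h1).isHomogeneous
    · rw [h2, truncRel_self, h0, zero_smul]
      exact isHomogeneous_zero _ _ _
    · exact isHomogeneous_truncRel a

lemma specIdeal_le_specIdeal_succ {s : ℕ} (hs : 1 ≤ s) (hsn : s ≤ n)
    {L : ℕ → MvPolynomial (Fin n) ℝ} {α : MvPolynomial (Fin n) ℝ} (hα : IsRelFactor n s α)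
    {a a' : ℕ → ℕ → ℝ} (ha' : ∀ i, s < i → α ∣ truncRel n s a i - truncRel n (s + 1) a' i) :
    specIdeal n s L a ≤ specIdeal n (s + 1) (Function.update L s α) a' := by
  have hmem : α ∈ specIdeal n (s + 1) (Function.update L s α) a' := by
    simpa [specGen] using specGen_mem (s := s + 1) (L := Function.update L s α) (a := a') hs hsn
  refine Ideal.span_le.2 ?_
  rintro _ ⟨i, ⟨h1, h2⟩, rfl⟩
  have hi := specGen_mem (s := s + 1) (L := Function.update L s α) (a := a') h1 h2
  rw [SetLike.mem_coe]
  simp only [specGen] at hi ⊢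
  rcases lt_trichotomy i s with h | rfl | h
  · simpa [h, h.le, h.ne, Nat.lt_succ_of_lt h] using hi
  · simpa using Ideal.mem_of_dvd _ (hα.dvd_truncRel_self a) hmem
  · rw [if_neg (by omega)] at hi
    rw [if_neg (by omega), ← sub_add_cancel (truncRel n s a i) (truncRel n (s + 1) a' i)]
    exact add_mem (Ideal.mem_of_dvd _ (ha' i h) hmem) hi

lemma specIdeal_succ_le_sup {s : ℕ}
    {L : ℕ → MvPolynomial (Fin n) ℝ} {α : MvPolynomial (Fin n) ℝ}
    {a a' : ℕ → ℕ → ℝ} (ha' : ∀ i, s < i → α ∣ truncRel n s a i - truncRel n (s + 1) a' i) :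
    specIdeal n (s + 1) (Function.update L s α) a' ≤ specIdeal n s L a ⊔ Ideal.span {α} := by
  have hmem : α ∈ specIdeal n s L a ⊔ Ideal.span {α} :=
    Ideal.mem_sup_right (Ideal.mem_span_singleton_self α)
  refine Ideal.span_le.2 ?_
  rintro _ ⟨i, ⟨h1, h2⟩, rfl⟩
  have hi : specGen n s L a i ∈ specIdeal n s L a ⊔ Ideal.span {α} :=
    Ideal.mem_sup_left (specGen_mem h1 h2)
  rw [SetLike.mem_coe]
  simp only [specGen] at hi ⊢
  rcases lt_trichotomy i s with h | rfl | h
  · simpa [h, h.le, h.ne, Nat.lt_succ_of_lt h] using hi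
  · simpa using hmem
  · rw [if_neg (by omega)] at hi
    rw [if_neg (by omega), ← sub_sub_cancel (truncRel n s a i) (truncRel n (s + 1) a' i)]
    exact sub_mem hi (Ideal.mem_of_dvd _ (ha' i h) hmem)

/-- The product `α_{i,w⁽ⁱ⁾(n)}·α_{i,w⁽ⁱ⁾(n−1)}···α_{i,w⁽ⁱ⁾(n−m+1)}`. -/
def rootChain (n : ℕ) (w : ℕ → Equiv.Perm ℕ) (i m : ℕ) : MvPolynomial (Fin n) ℝ :=
  ∏ t ∈ Finset.range m, (xv n i - xv n (w i (n - t)))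

/-- The span of the products of root chains for `s ≤ i ≤ n`. -/
def rootSpan (n : ℕ) (w : ℕ → Equiv.Perm ℕ) (s : ℕ) : Submodule ℝ (MvPolynomial (Fin n) ℝ) :=
  Submodule.span ℝ {p | ∃ m : ℕ → ℕ, (∀ i, m i ≤ n - i) ∧
    p = ∏ i ∈ Finset.Icc s n, rootChain n w i (m i)}

lemma rootChain_mul_mem_rootSpan {w : ℕ → Equiv.Perm ℕ} {s m : ℕ} (hsn : s ≤ n) (hm : m ≤ n - s)
    {u : MvPolynomial (Fin n) ℝ} (hu : u ∈ rootSpan n w (s + 1)) :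
    rootChain n w s m * u ∈ rootSpan n w s := by
  have h := Submodule.mem_map_of_mem (f := LinearMap.mulLeft ℝ (rootChain n w s m)) hu
  rw [rootSpan, Submodule.map_span] at h
  refine Submodule.span_mono ?_ h
  rintro _ ⟨_, ⟨μ, hμ, rfl⟩, rfl⟩
  refine ⟨Function.update μ s m, fun i => ?_, ?_⟩
  · by_cases hi : i = s
    · subst hi; simpa using hm
    · simpa [hi] using hμ i
  · rw [← Finset.insert_Icc_add_one_left_eq_Icc hsn, Finset.prod_insert (by simp),
      LinearMap.mulLeft_apply, Function.update_self]
    congr 1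
    refine Finset.prod_congr rfl fun i hi => ?_
    rw [Function.update_of_ne]
    have := (Finset.mem_Icc.1 hi).1
    omega

lemma rootChain_full {w : ℕ → Equiv.Perm ℕ} {s : ℕ}
    (hw : ∀ j ∈ Finset.Icc (s + 1) n, w s j ∈ Finset.Icc (s + 1) n) :
    rootChain n w s (n - s) = ∏ ℓ ∈ Finset.Icc (s + 1) n, (xv n s - xv n ℓ) := by
  refine Finset.prod_bij (fun t _ => w s (n - t)) (fun t ht => ?_) (fun t ht t' ht' h => ?_)
    (fun ℓ hℓ => ?_) (fun _ _ => rfl)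
  · rw [Finset.mem_range] at ht
    exact hw _ (Finset.mem_Icc.2 ⟨by omega, by omega⟩)
  · rw [Finset.mem_range] at ht ht'
    have := (w s).injective h
    omega
  · obtain ⟨j, hj, rfl⟩ := Finset.surj_on_of_inj_on_of_card_le (fun j _ => w s j) hw
      (fun _ _ _ _ h => (w s).injective h) le_rfl ℓ hℓ
    rw [Finset.mem_Icc] at hj
    refine ⟨n - j, Finset.mem_range.2 (by omega), ?_⟩
    rw [Nat.sub_sub_self hj.2]

lemma xv_mem_specIdeal {L : ℕ → MvPolynomial (Fin n) ℝ}
    (hL : ∀ i ≤ n, IsRelFactor n i (L i)) (a : ℕ → ℕ → ℝ) {i : ℕ} (hi : 1 ≤ i) (hin : i ≤ n) :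
    xv n i ∈ specIdeal n (n + 1) L a := by
  induction h : n - i using Nat.strong_induction_on generalizing i with
  | _ r ih =>
  have hmem := specGen_mem (s := n + 1) (L := L) (a := a) hi hin
  rw [specGen, if_pos (by omega)] at hmem
  obtain hα | ⟨ℓ, hℓ, hα⟩ := hL i hin
  · rwa [hα] at hmem
  · rw [Finset.mem_Icc] at hℓ
    rw [hα] at hmem
    rw [← sub_add_cancel (xv n i) (xv n ℓ)]
    exact add_mem hmem (ih (n - ℓ) (by omega) (by omega) hℓ.2 rfl)

lemma X_eq_xv (i : Fin n) : (X i : MvPolynomial (Fin n) ℝ) = xv n (i + 1) := by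
  rw [xv, dif_pos ⟨by omega, i.2⟩]
  simp

/-- Finite dimensional quotients by partially specialized ideals are spanned by products of
root chains. -/
theorem specIdeal_sup_rootSpan_eq_top {w : ℕ → Equiv.Perm ℕ}
    (hw : ∀ i ∈ Finset.Icc 1 (n - 1), ∀ j ∈ Finset.Icc (i + 1) n,
      w i j ∈ Finset.Icc (i + 1) n)
    {s : ℕ} (hs : 1 ≤ s) (hsn : s ≤ n + 1) {L : ℕ → MvPolynomial (Fin n) ℝ}
    (hL : ∀ i < s, IsRelFactor n i (L i)) {a : ℕ → ℕ → ℝ}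
    (hfin : FiniteDimensional ℝ (MvPolynomial (Fin n) ℝ ⧸ specIdeal n s L a)) :
    (specIdeal n s L a).restrictScalars ℝ ⊔ rootSpan n w s = ⊤ := by
  induction hr : n + 1 - s generalizing s L a with
  | zero =>
    obtain rfl : s = n + 1 := by omega
    rw [eq_top_iff]
    rintro p -
    induction p using MvPolynomial.induction_on with
    | C c =>
      refine Submodule.mem_sup_right ?_
      rw [← mul_one (C c), ← smul_eq_C_mul]
      exact Submodule.smul_mem _ _ (Submodule.subset_span ⟨0, by simp, by simp⟩)
    | add p q hp hq => exact add_mem hp hq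
    | mul_X p i _ =>
      refine Submodule.mem_sup_left ?_
      rw [Submodule.restrictScalars_mem, X_eq_xv]
      exact Ideal.mul_mem_left _ _
        (xv_mem_specIdeal (fun i hi => hL i (by omega)) a (by omega) i.2)
  | succ r ih =>
    replace hsn : s ≤ n := by omega
    set M := (specIdeal n s L a).restrictScalars ℝ ⊔ rootSpan n w s
    have hstep : ∀ {α : MvPolynomial (Fin n) ℝ} {m : ℕ}, IsRelFactor n s α → m ≤ n - s →
        (∀ q, rootChain n w s m * α * q ∈ M) → ∀ p, rootChain n w s m * p ∈ M := by
      intro α m hα hm hq p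
      obtain ⟨a', ha'⟩ := hα.exists_dvd_truncRel_sub a
      have hle := specIdeal_le_specIdeal_succ (L := L) hs hsn hα ha'
      have htop := ih (s := s + 1) (L := Function.update L s α) (a := a') (by omega) (by omega)
        (fun i hi => by
          by_cases h : i = s
          · subst h; simpa using hα
          · simpa [h] using hL i (by omega))
        (Module.Finite.of_surjective (Ideal.Quotient.factorₐ ℝ hle).toLinearMap
          (Ideal.Quotient.factor_surjective hle)) (by omega)
      obtain ⟨j, hj, u, hu, rfl⟩ := Submodule.mem_sup.1 (htop ▸ Submodule.mem_top (x := p))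
      obtain ⟨j₀, hj₀, z, hz, rfl⟩ := Submodule.mem_sup.1 (specIdeal_succ_le_sup ha' hj)
      obtain ⟨q, rfl⟩ := Ideal.mem_span_singleton.1 hz
      rw [mul_add, mul_add, ← mul_assoc _ α]
      exact add_mem (add_mem (Submodule.mem_sup_left (Ideal.mul_mem_left _ _ hj₀)) (hq q))
        (Submodule.mem_sup_right (rootChain_mul_mem_rootSpan hsn hm hu))
    have hw' : ∀ j ∈ Finset.Icc (s + 1) n, w s j ∈ Finset.Icc (s + 1) n := fun j hj =>
      hw s (by rw [Finset.mem_Icc] at hj ⊢; omega) j hj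
    have hchain : ∀ k m, m + k = n - s → ∀ p, rootChain n w s m * p ∈ M := by
      intro k
      induction k with
      | zero =>
        rintro m hm
        obtain rfl : m = n - s := by omega
        refine hstep (Or.inl rfl) le_rfl fun q => Submodule.mem_sup_left ?_
        refine Ideal.mul_mem_right _ _ ?_
        have ha := leadingCoeff_ne_zero_of_finiteDimensional hs hsn hL hfin
        have hmem := specGen_mem (s := s) (L := L) (a := a) hs hsn
        rw [specGen, if_neg (lt_irrefl s), truncRel_self] at hmem
        have := Submodule.smul_of_tower_mem (specIdeal n s L a) (a s s)⁻¹ hmem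
        rwa [inv_smul_smul₀ ha, relTerm, ← rootChain_full hw'] at this
      | succ k ihk =>
        intro m hm
        refine hstep (α := xv n s - xv n (w s (n - m)))
          (Or.inr ⟨_, hw' _ (Finset.mem_Icc.2 ⟨by omega, by omega⟩), rfl⟩) (by omega) fun q => ?_
        have := ihk (m + 1) (by omega) q
        rwa [rootChain, Finset.prod_range_succ] at this
    rw [eq_top_iff]
    rintro p -
    simpa [rootChain] using hchain (n - s) 0 (by omega) p

end Spanning

/-- **Proposition 5.4.** If `R^{A}` is Artinian (finite dimensional over ℝ), then for any
choice of permutations `w⁽ⁱ⁾` of `{i+1,…,n}`, the products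
`∏_{i=1}^{n-1} α_{i,w⁽ⁱ⁾(n)}···α_{i,w⁽ⁱ⁾(n−m_i+1)}` with `0 ≤ m_i ≤ n−i` form an ℝ-basis
of `R^{A}`. -/
theorem stmt_2 (n : ℕ) (hn : 1 ≤ n) (a : ℕ → ℕ → ℚ)
    (hart : FiniteDimensional ℝ (MvPolynomial (Fin n) ℝ ⧸ IA n a))
    (w : ℕ → Equiv.Perm ℕ)
    (hw : ∀ i ∈ Finset.Icc 1 (n - 1), ∀ j ∈ Finset.Icc (i + 1) n,
      w i j ∈ Finset.Icc (i + 1) n) :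
    LinearIndependent ℝ (basA n a w) ∧
      Submodule.span ℝ (Set.range (basA n a w)) = ⊤ := by
  obtain ⟨k, rfl⟩ : ∃ k, n = k + 1 := ⟨n - 1, by omega⟩
  have hspan : Submodule.span ℝ (Set.range (basA (k + 1) a w)) = ⊤ := by
    have htop := specIdeal_sup_rootSpan_eq_top hw le_rfl (by omega)
      (L := fun _ => xv (k + 1) 0) (a := fun i k => (a i k : ℝ))
      (fun i hi => Or.inl (by rw [Nat.lt_one_iff.1 hi])) (by rwa [specIdeal_one])
    rw [specIdeal_one] at htop
    rw [eq_top_iff]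
    rintro x -
    obtain ⟨p, rfl⟩ := Ideal.Quotient.mk_surjective x
    obtain ⟨j, hj, u, hu, rfl⟩ := Submodule.mem_sup.1 (htop ▸ Submodule.mem_top (x := p))
    rw [map_add, Ideal.Quotient.eq_zero_iff_mem.2 hj, zero_add]
    have h := Submodule.mem_map_of_mem
      (f := (Ideal.Quotient.mkₐ ℝ (IA (k + 1) a)).toLinearMap) hu
    rw [rootSpan, Submodule.map_span] at h
    refine Submodule.span_mono ?_ h
    rintro _ ⟨_, ⟨m, hm, rfl⟩, rfl⟩
    refine ⟨fun i => ⟨m (i + 1), Nat.lt_succ_of_le (hm _)⟩, congrArg (Ideal.Quotient.mk _) ?_⟩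
    have hlast : m (k + 1) = 0 := by simpa using hm (k + 1)
    rw [← Finset.Ico_add_one_right_eq_Icc, Finset.prod_Ico_eq_prod_range,
      show k + 1 + 1 - 1 = k + 1 from rfl, Finset.prod_range_succ, Finset.prod_range,
      add_comm 1 k, hlast]
    simp only [rootChain, Finset.range_zero, Finset.prod_empty, mul_one, add_comm 1]
    rfl
  refine ⟨linearIndependent_of_top_le_span_of_card_eq_finrank hspan.ge (le_antisymm ?_ ?_), hspan⟩
  · have h := prod_degree_le_finrank_quotient_span_image (n := k + 1) (g := fA (k + 1) a)
      (d := fun i => k + 1 - i + 1) (fun _ => Nat.succ_pos _)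
      (fun i _ => isHomogeneous_truncRel (s := 1) fun i k => (a i k : ℝ)) hart
    refine le_trans (le_of_eq ?_) h
    rw [Fin.prod_univ_castSucc, Fintype.card_pi]
    simp
  · rw [← finrank_top, ← hspan]
    exact finrank_range_le_card _
end
end

section
/- Let h be a Hessenberg function for type B_n, and for each i = 1,…,n fix a permutation w^{(i)} of the set {i+1, i+2, …, h(i)}. Then the classes ∏_{i=1}^{n} α^{B}_{i,w^{(i)}(h(i))}·α^{B}_{i,w^{(i)}(h(i)−1)}···α^{B}_{i,w^{(i)}(h(i)−m_i+1)}, indexed by tuples (m_1,…,m_n) with 0 ≤ m_i ≤ h(i)−i (an empty product being 1), form a basis of the ℝ-vector space R^{B}_{h} = ℝ[x_1,…,x_n]/(f^{B}_{1,h(1)},…,f^{B}_{n,h(n)}). -/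
open MvPolynomial

noncomputable section

/-- The type `B_n` root label `α^{B}_{i,j}`: `x_i − x_j` for `i+1 ≤ j ≤ n`, `x_i` for
`j = n+1`, and `x_i + x_{2n+2−j}` for `n+2 ≤ j ≤ 2n+1−i`. -/
def alB (n i j : ℕ) : MvPolynomial (Fin n) ℝ :=
  if j ≤ n then xv n i - xv n j
  else if j = n + 1 then xv n i
  else xv n i + xv n (2 * n + 2 - j)

/-- The polynomial `f^{B}_{i,j} = Σ_{k=1}^{i}(∏_{ℓ=i+1}^{j} α^{B}_{k,ℓ})·x_k`. -/
def fBij (n i j : ℕ) : MvPolynomial (Fin n) ℝ :=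
  ∑ k ∈ Finset.Icc 1 i, (∏ ℓ ∈ Finset.Icc (i + 1) j, alB n k ℓ) * xv n k

/-- The ideal `(f^{B}_{1,h(1)}, …, f^{B}_{n,h(n)})`,
so that `R^{B}_h = ℝ[x_1,…,x_n]/IBh n h ≅ H^*(Hess(N,h);ℝ)` in type `B_n`. -/
def IBh (n : ℕ) (h : ℕ → ℕ) : Ideal (MvPolynomial (Fin n) ℝ) :=
  Ideal.span ((fun i => fBij n i (h i)) '' Set.Icc 1 n)

/-- The class of `∏_{i=1}^{n} α^{B}_{i,w⁽ⁱ⁾(h(i))}···α^{B}_{i,w⁽ⁱ⁾(h(i)−m_i+1)}` in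
`R^{B}_h`. -/
def basBh (n : ℕ) (h : ℕ → ℕ) (w : ℕ → Equiv.Perm ℕ)
    (m : (i : Fin n) → Fin (h (i.val + 1) - (i.val + 1) + 1)) :
    MvPolynomial (Fin n) ℝ ⧸ IBh n h :=
  Ideal.Quotient.mk (IBh n h)
    (∏ i : Fin n, ∏ t ∈ Finset.range (m i : ℕ),
      alB n (i.val + 1) (w (i.val + 1) (h (i.val + 1) - t)))

/-- Every syzygy of the family `f` is a combination of the Koszul relations `f_j e_i - f_i e_j`. -/
def KoszulSyzygies {R : Type*} [CommRing R] {n : ℕ} (f : Fin n → R) : Prop :=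
  ∀ r : Fin n → R, ∑ i, r i * f i = 0 →
    ∃ s : Fin n → Fin n → R, (∀ i j, s i j = - s j i) ∧ (∀ i, s i i = 0) ∧
      ∀ i, r i = ∑ j, s i j * f j

/-- The syzygies of `f` are Koszul, and `e` is a basis of an `ℝ`-complement of the ideal
generated by `f`. -/
structure KoszulBasis {R : Type*} [CommRing R] [Algebra ℝ R] {n : ℕ} {K : Type*} [Fintype K]
    (f : Fin n → R) (e : K → R) : Prop where
  koszul : KoszulSyzygies f
  indep : ∀ (a : K → ℝ) (r : Fin n → R), ∑ k, a k • e k = ∑ i, r i * f i → ∀ k, a k = 0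
  spans : ∀ p : R, ∃ (a : K → ℝ) (r : Fin n → R), p = ∑ k, a k • e k + ∑ i, r i * f i

theorem KoszulBasis.reindex {R : Type*} [CommRing R] [Algebra ℝ R] {n : ℕ} {K L : Type*}
    [Fintype K] [Fintype L] {f : Fin n → R} {e : K → R} (H : KoszulBasis f e) (σ : L ≃ K) :
    KoszulBasis f (e ∘ σ) where
  koszul := H.koszul
  indep a r har k := by
    have := H.indep (a ∘ σ.symm) r (by
      rw [← har, ← σ.sum_comp]; simp) (σ k)
    simpa using this
  spans p := by
    obtain ⟨a, r, h⟩ := H.spans p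
    refine ⟨a ∘ σ, r, ?_⟩
    rw [h, ← σ.sum_comp]; rfl

theorem sum_alternating_eq_zero {R : Type*} [CommRing R] {n : ℕ} (s : Fin n → Fin n → R)
    (hs : ∀ i j, s i j = - s j i) (hd : ∀ i, s i i = 0) (g : Fin n → R) :
    ∑ i, (∑ j, s i j * g j) * g i = 0 := by
  simp_rw [Finset.sum_mul]
  rw [← Finset.sum_product']
  refine Finset.sum_involution (fun p _ => (p.2, p.1)) ?_ ?_ ?_ ?_
  · rintro ⟨i, j⟩ _
    simp only [hs i j]; ring
  · rintro ⟨i, j⟩ _ h0 h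
    simp only [Prod.mk.injEq] at h
    obtain ⟨rfl, -⟩ := h
    simp [hd] at h0
  · simp
  · simp

theorem sum_koszul_add {R : Type*} [CommRing R] {n : ℕ} {s : Fin n → Fin n → R} (hs : ∀ i j, s i j = - s j i)
    (hd : ∀ i, s i i = 0) {g r r' : Fin n → R} {β : R}
    (h : ∀ i, r i = ∑ j, s i j * g j + β * r' i) :
    ∑ i, r i * g i = β * ∑ i, r' i * g i := by
  simp only [h, add_mul, Finset.sum_add_distrib]
  rw [sum_alternating_eq_zero s hs hd, zero_add, Finset.mul_sum]
  simp only [mul_assoc]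

section Step

variable {A R K : Type*} [CommRing A] [Algebra ℝ A] [CommRing R] [Algebra ℝ R]
  [Fintype K] {n : ℕ}

/-- A combination of the `g i` divisible by `β` has coefficients divisible by `β` up to Koszul
relations, provided that the syzygies of the `g i` modulo `β` are Koszul. -/
theorem exists_coeff_of_dvd {ι : A →ₐ[ℝ] R} {φ : R →ₐ[ℝ] A} {β : R}
    (hβ : φ β = 0) (hker : ∀ p, β ∣ p - ι (φ p)) {g : Fin n → R}
    (H : KoszulSyzygies fun i => φ (g i)) (r : Fin n → R) (v : R)
    (hr : ∑ i, r i * g i = β * v) :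
    ∃ (s : Fin n → Fin n → R) (r' : Fin n → R), (∀ i j, s i j = - s j i) ∧ (∀ i, s i i = 0) ∧
      (∀ i, r i = ∑ j, s i j * g j + β * r' i) := by
  obtain ⟨s, hs, hd, h⟩ := H (fun i => φ (r i)) (by
    have := congrArg φ hr
    simpa [hβ] using this)
  have key : ∀ i, ∃ q, r i = ∑ j, ι (s i j) * g j + β * q := by
    intro i
    choose q hq using fun j => hker (g j)
    obtain ⟨q₀, hq₀⟩ := hker (r i)
    refine ⟨q₀ - ∑ j, ι (s i j) * q j, ?_⟩
    have h1 : r i = ι (φ (r i)) + β * q₀ := by rw [← hq₀]; ring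
    have h2 : ∀ j, ι (φ (g j)) = g j - β * q j := fun j => by rw [← hq]; ring
    rw [h1, h i, map_sum]
    simp only [map_mul, h2, mul_sub, Finset.sum_sub_distrib, Finset.mul_sum]
    have h3 : ∀ j, ι (s i j) * (β * q j) = β * (ι (s i j) * q j) := fun j => by ring
    simp only [h3]; ring
  choose r' hr' using key
  exact ⟨fun i j => ι (s i j), r', fun i j => by simpa using congrArg ι (hs i j),
    fun i => by simp [hd], hr'⟩

variable {ι : A →ₐ[ℝ] R}

theorem exists_coeff_of_prod_dvd [IsDomain R] {β : ℕ → R} (hβ0 : ∀ t, β t ≠ 0)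
    {φ : ℕ → R →ₐ[ℝ] A} (hβ : ∀ t, φ t (β t) = 0) (hker : ∀ t p, β t ∣ p - ι (φ t p))
    {g : Fin n → R} (H : ∀ t, KoszulSyzygies fun i => φ t (g i)) (d : ℕ) (r : Fin n → R)
    (v : R) (hr : ∑ i, r i * g i = (∏ t ∈ Finset.range d, β t) * v) :
    ∃ (s : Fin n → Fin n → R) (r' : Fin n → R), (∀ i j, s i j = - s j i) ∧ (∀ i, s i i = 0) ∧
      (∀ i, r i = ∑ j, s i j * g j + (∏ t ∈ Finset.range d, β t) * r' i) := by
  induction d generalizing v with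
  | zero => exact ⟨fun _ _ => 0, r, by simp⟩
  | succ d ih =>
    obtain ⟨s, r', hs, hd, h⟩ := ih (β d * v) (by rw [hr, Finset.prod_range_succ]; ring)
    have h1 := sum_koszul_add hs hd h
    rw [hr, Finset.prod_range_succ, mul_assoc] at h1
    have h2 := mul_left_cancel₀ (Finset.prod_ne_zero_iff.2 fun t _ => hβ0 t) h1
    obtain ⟨s', r'', hs', hd', h'⟩ := exists_coeff_of_dvd (hβ d) (hker d) (H d) r' v h2.symm
    refine ⟨fun i j => s i j + (∏ t ∈ Finset.range d, β t) * s' i j, r'', ?_, ?_, ?_⟩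
    · intro i j; simp only [hs i j, hs' i j]; ring
    · intro i; simp [hd, hd']
    · intro i
      rw [h, h', Finset.prod_range_succ, mul_add, Finset.mul_sum]
      simp only [add_mul, Finset.sum_add_distrib, mul_assoc]
      ring

theorem indep_of_filtration [IsDomain R] {β : ℕ → R} (hβ0 : ∀ t, β t ≠ 0) {φ : ℕ → R →ₐ[ℝ] A}
    (hφ : ∀ t a, φ t (ι a) = a) (hβ : ∀ t, φ t (β t) = 0)
    (hker : ∀ t p, β t ∣ p - ι (φ t p)) {g : Fin n → R} {e : K → A}
    (H : ∀ t, KoszulBasis (fun i => φ t (g i)) e) (d : ℕ) (a : ℕ → K → ℝ) (r : Fin n → R)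
    (v : R) (hr : ∑ j ∈ Finset.range d, (∏ t ∈ Finset.range j, β t) * ι (∑ k, a j k • e k) +
      (∏ t ∈ Finset.range d, β t) * v = ∑ i, r i * g i) :
    ∀ j < d, ∀ k, a j k = 0 := by
  induction d generalizing β φ a r v with
  | zero => simp
  | succ d ih =>
    rw [Finset.sum_range_succ', Finset.prod_range_succ'] at hr
    simp only [Finset.prod_range_succ', Finset.prod_range_zero, one_mul] at hr
    have h0 : ∀ k, a 0 k = 0 := by
      refine (H 0).indep (a 0) (fun i => φ 0 (r i)) ?_
      have := congrArg (φ 0) hr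
      simpa only [map_add, map_sum, map_mul, hβ, mul_zero, zero_mul, Finset.sum_const_zero,
        zero_add, add_zero, hφ, map_smul] using this
    have hr' : ∑ i, r i * g i = β 0 *
        (∑ j ∈ Finset.range d, (∏ t ∈ Finset.range j, β (t + 1)) * ι (∑ k, a (j + 1) k • e k) +
        (∏ t ∈ Finset.range d, β (t + 1)) * v) := by
      rw [← hr]
      simp only [h0, zero_smul, Finset.sum_const_zero, map_zero, add_zero, mul_add,
        Finset.mul_sum]
      congr 1
      · exact Finset.sum_congr rfl fun j _ => by ring
      · ring
    obtain ⟨s, r', hs, hd, h⟩ := exists_coeff_of_dvd (hβ 0) (hker 0) (H 0).koszul r _ hr'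
    rw [sum_koszul_add hs hd h] at hr'
    have := ih (β := fun t => β (t + 1)) (φ := fun t => φ (t + 1)) (fun t => hβ0 _)
      (fun t => hφ _) (fun t => hβ _) (fun t => hker _) (fun t => H _) (fun j => a (j + 1)) r' v
      (mul_left_cancel₀ (hβ0 0) hr').symm
    rintro (_ | j) hj k
    · exact h0 k
    · exact this j (by omega) k

theorem spans_of_filtration {β : ℕ → R} {φ : ℕ → R →ₐ[ℝ] A}
    (hker : ∀ t p, β t ∣ p - ι (φ t p)) {g : Fin n → R} {e : K → A}
    (H : ∀ t, KoszulBasis (fun i => φ t (g i)) e) (d : ℕ) (p : R) :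
    ∃ (a : ℕ → K → ℝ) (r : Fin n → R) (v : R),
      p = ∑ j ∈ Finset.range d, (∏ t ∈ Finset.range j, β t) * ι (∑ k, a j k • e k) +
        ∑ i, r i * g i + (∏ t ∈ Finset.range d, β t) * v := by
  induction d generalizing β φ p with
  | zero => exact ⟨0, 0, p, by simp⟩
  | succ d ih =>
    obtain ⟨a₀, r₀, h₀⟩ := (H 0).spans (φ 0 p)
    choose q hq using fun i => hker 0 (g i)
    obtain ⟨q₀, hq₀⟩ := hker 0 p
    obtain ⟨a, r, v, h⟩ := ih (β := fun t => β (t + 1)) (φ := fun t => φ (t + 1))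
      (fun t => hker _) (fun t => H _) (q₀ - ∑ i, ι (r₀ i) * q i)
    refine ⟨fun j => Nat.casesOn j a₀ a, fun i => ι (r₀ i) + β 0 * r i, v, ?_⟩
    rw [Finset.sum_range_succ', Finset.prod_range_succ']
    simp only [Finset.prod_range_succ', Finset.prod_range_zero, one_mul]
    have h2 : ∀ j, ι (φ 0 (g j)) = g j - β 0 * q j := fun j => by rw [← hq]; ring
    have h1 : p = ι (∑ k, a₀ k • e k) + ∑ i, ι (r₀ i) * g i +
        β 0 * (q₀ - ∑ i, ι (r₀ i) * q i) := by
      have h3 : p = ι (φ 0 p) + β 0 * q₀ := by rw [← hq₀]; ring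
      rw [h3, h₀, map_add, map_sum ι (fun i => r₀ i * _)]
      simp only [map_mul, h2, mul_sub, Finset.sum_sub_distrib, Finset.mul_sum]
      have h4 : ∀ j, ι (r₀ j) * (β 0 * q j) = β 0 * (ι (r₀ j) * q j) := fun j => by ring
      simp only [h4]; ring
    rw [h1, h]
    simp only [mul_add, Finset.mul_sum, add_mul, Finset.sum_add_distrib]
    have h5 : ∀ j, β 0 * ((∏ t ∈ Finset.range j, β (t + 1)) * ι (∑ k, a j k • e k)) =
      (∏ t ∈ Finset.range j, β (t + 1)) * β 0 * ι (∑ k, a j k • e k) := fun j => by ring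
    simp only [h5, mul_assoc, Nat.rec_zero]
    ring

/-- If `f 0` is a scalar multiple of `β 0 * ⋯ * β (d - 1)` and the remaining `f i` have a common
`KoszulBasis` modulo each `β t`, then that basis times the partial products of the `β t` is a
`KoszulBasis` for `f`. -/
theorem KoszulBasis.of_filtration [IsDomain R] {β : ℕ → R} (hβ0 : ∀ t, β t ≠ 0) {φ : ℕ → R →ₐ[ℝ] A}
    (hφ : ∀ t a, φ t (ι a) = a) (hβ : ∀ t, φ t (β t) = 0)
    (hker : ∀ t p, β t ∣ p - ι (φ t p)) {f : Fin (n + 1) → R} {e : K → A}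
    (H : ∀ t, KoszulBasis (fun i => φ t (f (Fin.succ i))) e) (d : ℕ) {c : ℝ} (hc : c ≠ 0)
    (hf : f 0 = algebraMap ℝ R c * ∏ t ∈ Finset.range d, β t) :
    KoszulBasis f (fun jk : Fin d × K => (∏ t ∈ Finset.range jk.1, β t) * ι (e jk.2)) := by
  have hcc : algebraMap ℝ R c⁻¹ * algebraMap ℝ R c = 1 := by
    rw [← map_mul, inv_mul_cancel₀ hc, map_one]
  have hsum : ∀ a : ℕ → K → ℝ, ∑ jk : Fin d × K, a jk.1 jk.2 •
      ((∏ t ∈ Finset.range jk.1, β t) * ι (e jk.2)) =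
      ∑ j ∈ Finset.range d, (∏ t ∈ Finset.range j, β t) * ι (∑ k, a j k • e k) := by
    intro a
    rw [Fintype.sum_prod_type, Finset.sum_range]
    refine Finset.sum_congr rfl fun j _ => ?_
    simp only [map_sum, map_smul, Finset.mul_sum, mul_smul_comm]
  have hP : ∏ t ∈ Finset.range d, β t ≠ 0 := Finset.prod_ne_zero_iff.2 fun t _ => hβ0 t
  refine ⟨?_, ?_, ?_⟩
  · intro r hr
    rw [Fin.sum_univ_succ, hf] at hr
    obtain ⟨s, r', hs, hd, h⟩ := exists_coeff_of_prod_dvd hβ0 hβ hker (fun t => (H t).koszul) d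
      (fun i => r i.succ) (- (algebraMap ℝ R c * r 0)) (by linear_combination hr)
    have h1 := sum_koszul_add hs hd h
    have h2 : algebraMap ℝ R c * r 0 = - ∑ i, r' i * f i.succ := by
      apply mul_left_cancel₀ hP
      linear_combination hr - h1
    refine ⟨Fin.cons (Fin.cons 0 fun j => - (algebraMap ℝ R c⁻¹ * r' j))
      (fun i => Fin.cons (algebraMap ℝ R c⁻¹ * r' i) (s i)), ?_, ?_, ?_⟩
    · intro i j
      refine Fin.cases ?_ (fun i => ?_) i <;> refine Fin.cases ?_ (fun j => ?_) j <;> simp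
      exact hs i j
    · intro i
      refine Fin.cases ?_ (fun i => ?_) i <;> simp [hd]
    · intro i
      refine Fin.cases ?_ (fun i => ?_) i
      · simp only [Fin.sum_univ_succ, Fin.cons_zero, Fin.cons_succ, zero_mul, zero_add, neg_mul,
          Finset.sum_neg_distrib, mul_assoc, ← Finset.mul_sum]
        linear_combination (algebraMap ℝ R c⁻¹) * h2 - r 0 * hcc
      · simp only [Fin.sum_univ_succ, Fin.cons_zero, Fin.cons_succ]
        rw [h, hf]
        linear_combination - (∏ t ∈ Finset.range d, β t) * r' i * hcc
  · intro a r har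
    set a' : ℕ → K → ℝ := fun j k => if h : j < d then a (⟨j, h⟩, k) else 0 with ha'
    have haa : ∀ jk : Fin d × K, a jk = a' jk.1 jk.2 := fun jk => by simp [ha']
    simp only [haa] at har
    rw [hsum, Fin.sum_univ_succ, hf] at har
    have := indep_of_filtration hβ0 hφ hβ hker H d a' (fun i => r i.succ)
      (- (r 0 * algebraMap ℝ R c)) (by rw [har]; ring)
    intro jk
    rw [haa]
    exact this _ jk.1.2 _
  · intro p
    obtain ⟨a, r, v, h⟩ := spans_of_filtration hker H d p
    refine ⟨fun jk => a jk.1 jk.2, Fin.cons (v * algebraMap ℝ R c⁻¹) r, ?_⟩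
    rw [hsum, h, Fin.sum_univ_succ, hf]
    simp only [Fin.cons_zero, Fin.cons_succ]
    linear_combination - (∏ t ∈ Finset.range d, β t) * v * hcc

end Step

/-- The element `y_j` with `alB n i j = x_i - y_j`. -/
def yv (n j : ℕ) : MvPolynomial (Fin n) ℝ :=
  if j ≤ n then xv n j else if j = n + 1 then 0 else - xv n (2 * n + 2 - j)

theorem alB_eq (n i j : ℕ) : alB n i j = xv n i - yv n j := by
  unfold alB yv
  split_ifs <;> simp

theorem yv_reflect (n j : ℕ) (h1 : 1 ≤ j) (h2 : j ≤ 2 * n + 1) :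
    yv n (2 * n + 2 - j) = - yv n j := by
  unfold yv
  split_ifs <;> first
    | omega
    | (simp; done)
    | (rw [show 2 * n + 2 - (2 * n + 2 - j) = j by omega])

theorem xv_succ_s4 (n k : ℕ) (hk : 1 ≤ k) :
    xv (n + 1) (k + 1) = rename Fin.succ (xv n k) := by
  unfold xv
  split_ifs with h h' h'
  · rw [rename_X]
    congr 1
    ext
    simp
    omega
  · omega
  · omega
  · simp

theorem xv_one (n : ℕ) : xv (n + 1) 1 = X 0 := by
  simp [xv]

theorem yv_zero (n : ℕ) : yv n 0 = 0 := by
  simp [yv, xv]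

theorem yv_succ (n j : ℕ) (hj : 1 ≤ j) (hj' : j ≤ 2 * n + 1) :
    yv (n + 1) (j + 1) = rename Fin.succ (yv n j) := by
  unfold yv
  split_ifs <;> first
    | omega
    | (simp; done)
    | exact xv_succ_s4 n j hj
    | (rw [map_neg, ← xv_succ_s4 _ _ (by omega)]; congr 2; omega)

/-- The evaluation `x_1 ↦ a`, `x_{k+1} ↦ x_k`. -/
def evalFirst {n : ℕ} (a : MvPolynomial (Fin n) ℝ) :
    MvPolynomial (Fin (n + 1)) ℝ →ₐ[ℝ] MvPolynomial (Fin n) ℝ :=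
  aeval (Fin.cons a X : Fin (n + 1) → MvPolynomial (Fin n) ℝ)

theorem evalFirst_rename {n : ℕ} (a p : MvPolynomial (Fin n) ℝ) :
    evalFirst a (rename Fin.succ p) = p := by
  unfold evalFirst
  rw [aeval_rename]
  have : (Fin.cons a X : Fin (n + 1) → MvPolynomial (Fin n) ℝ) ∘ Fin.succ = X := by
    ext1 i; simp
  rw [this, aeval_X_left_apply]

theorem evalFirst_X_zero {n : ℕ} (a : MvPolynomial (Fin n) ℝ) : evalFirst a (X 0) = a := by
  simp [evalFirst]

theorem dvd_sub_rename_evalFirst {n : ℕ} (a : MvPolynomial (Fin n) ℝ)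
    (p : MvPolynomial (Fin (n + 1)) ℝ) :
    X 0 - rename Fin.succ a ∣ p - rename Fin.succ (evalFirst a p) := by
  rw [← Ideal.mem_span_singleton, ← Ideal.Quotient.mk_eq_mk_iff_sub_mem]
  set I := Ideal.span {X 0 - rename Fin.succ a}
  have : Ideal.Quotient.mkₐ ℝ I =
      ((Ideal.Quotient.mkₐ ℝ I).comp (rename Fin.succ)).comp (evalFirst a) := by
    ext i
    refine Fin.cases ?_ (fun i => ?_) i
    · simp only [AlgHom.comp_apply, evalFirst_X_zero]
      exact (Ideal.Quotient.mk_eq_mk_iff_sub_mem _ _).2 (Ideal.mem_span_singleton_self _)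
    · simp [AlgHom.comp_apply, evalFirst]
  exact DFunLike.congr_fun this p

theorem X_zero_sub_rename_ne_zero {n : ℕ} (a : MvPolynomial (Fin n) ℝ) :
    X 0 - rename Fin.succ a ≠ 0 := by
  intro h
  have := congrArg (evalFirst (a + 1)) h
  rw [map_sub, evalFirst_X_zero, evalFirst_rename] at this
  simp at this

/-- The polynomial `z ∏_{ℓ=i+1}^{j} (z - y_ℓ)`. -/
def rootProd (n i j : ℕ) (z : MvPolynomial (Fin n) ℝ) : MvPolynomial (Fin n) ℝ :=
  (∏ ℓ ∈ Finset.Icc (i + 1) j, (z - yv n ℓ)) * z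

/-- The weighted version `∑_{k ≤ i} c_k x_k ∏_{ℓ=i+1}^{j} α_{k,ℓ}` of `fBij`. -/
def fBw (n : ℕ) (c : ℕ → ℝ) (i j : ℕ) : MvPolynomial (Fin n) ℝ :=
  ∑ k ∈ Finset.Icc 1 i, C (c k) * rootProd n i j (xv n k)

theorem fBw_one (n i j : ℕ) : fBw n 1 i j = fBij n i j := by
  simp [fBw, fBij, rootProd, alB_eq]

theorem rootProd_eq_zero {n i j ℓ : ℕ} (h1 : i < ℓ) (h2 : ℓ ≤ j) :
    rootProd n i j (yv n ℓ) = 0 := by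
  unfold rootProd
  rw [Finset.prod_eq_zero (i := ℓ) (Finset.mem_Icc.2 ⟨h1, h2⟩) (sub_self _), zero_mul]

theorem rootProd_neg {n i : ℕ} (hi : i ≤ n) (z : MvPolynomial (Fin n) ℝ) :
    rootProd n i (2 * n + 1 - i) (-z) = rootProd n i (2 * n + 1 - i) z := by
  unfold rootProd
  have h1 : ∏ ℓ ∈ Finset.Icc (i + 1) (2 * n + 1 - i), (-z - yv n ℓ) =
      ∏ ℓ ∈ Finset.Icc (i + 1) (2 * n + 1 - i), -(z - yv n ℓ) := by
    refine Finset.prod_nbij' (fun ℓ => 2 * n + 2 - ℓ) (fun ℓ => 2 * n + 2 - ℓ) ?_ ?_ ?_ ?_ ?_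
    · intro ℓ hℓ; simp only [Finset.mem_Icc] at *; omega
    · intro ℓ hℓ; simp only [Finset.mem_Icc] at *; omega
    · intro ℓ hℓ; simp only [Finset.mem_Icc] at *; omega
    · intro ℓ hℓ; simp only [Finset.mem_Icc] at *; omega
    · intro ℓ hℓ
      simp only [Finset.mem_Icc] at hℓ
      rw [yv_reflect _ _ (by omega) (by omega)]; ring
  have h2 : Odd (Finset.Icc (i + 1) (2 * n + 1 - i)).card := by
    rw [Nat.card_Icc]
    exact ⟨n - i, by omega⟩
  rw [h1, Finset.prod_neg, h2.neg_one_pow]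
  ring

theorem Icc_one_succ (i : ℕ) :
    Finset.Icc 1 (i + 1) = insert 1 ((Finset.Icc 1 i).image (· + 1)) := by
  ext k
  simp only [Finset.mem_Icc, Finset.mem_insert, Finset.mem_image]
  constructor
  · intro h
    by_cases hk : k = 1
    · exact Or.inl hk
    · exact Or.inr ⟨k - 1, by omega, by omega⟩
  · rintro (h | ⟨a, h, rfl⟩) <;> omega

theorem evalFirst_rootProd {n i j : ℕ} (hj : j ≤ 2 * n + 1) (a : MvPolynomial (Fin n) ℝ)
    (z : MvPolynomial (Fin (n + 1)) ℝ) :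
    evalFirst a (rootProd (n + 1) (i + 1) (j + 1) z) = rootProd n i j (evalFirst a z) := by
  unfold rootProd
  rw [map_mul, map_prod]
  congr 1
  symm
  refine Finset.prod_nbij' (· + 1) (· - 1) ?_ ?_ ?_ ?_ ?_
  · intro ℓ hℓ; simp only [Finset.mem_Icc] at *; omega
  · intro ℓ hℓ; simp only [Finset.mem_Icc] at *; omega
  · intro ℓ hℓ; simp only [Finset.mem_Icc] at *; omega
  · intro ℓ hℓ; simp only [Finset.mem_Icc] at *; omega
  · intro ℓ hℓ
    simp only [Finset.mem_Icc] at hℓ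
    rw [map_sub, yv_succ _ _ (by omega) (by omega), evalFirst_rename]

theorem evalFirst_fBw {n i j : ℕ} (hj : j ≤ 2 * n + 1) (a : MvPolynomial (Fin n) ℝ)
    (c : ℕ → ℝ) :
    evalFirst a (fBw (n + 1) c (i + 1) (j + 1)) =
      C (c 1) * rootProd n i j a + fBw n (fun k => c (k + 1)) i j := by
  unfold fBw
  rw [Icc_one_succ, Finset.sum_insert (by simp), Finset.sum_image (by simp), map_add, map_sum]
  have hC : ∀ r : ℝ, evalFirst a (C r) = C r := fun r => (evalFirst a).commutes r
  congr 1
  · rw [map_mul, hC, evalFirst_rootProd hj, xv_one, evalFirst_X_zero]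
  · refine Finset.sum_congr rfl fun k hk => ?_
    rw [map_mul, hC, evalFirst_rootProd hj, xv_succ_s4 _ _ (Finset.mem_Icc.1 hk).1,
      evalFirst_rename]

theorem fBw_add_single (n : ℕ) (c : ℕ → ℝ) (b : ℝ) (i j k₀ : ℕ) (hk₀ : 1 ≤ k₀) :
    fBw n (fun k => c k + if k = k₀ then b else 0) i j =
      (if k₀ ≤ i then C b * rootProd n i j (xv n k₀) else 0) + fBw n c i j := by
  unfold fBw
  simp only [map_add, add_mul, Finset.sum_add_distrib]
  rw [add_comm]
  congr 1
  have : ∀ k, C (if k = k₀ then b else 0) * rootProd n i j (xv n k) =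
      if k = k₀ then C b * rootProd n i j (xv n k) else 0 := by
    intro k; split_ifs <;> simp
  simp only [this]
  rw [Finset.sum_ite_eq']
  simp [hk₀]

/-- Specializing `x_1` to a `y_ℓ` turns the weighted polynomials into weighted polynomials in one
variable less, with positive weights again. -/
theorem exists_weights (n : ℕ) (D : ℕ → ℕ) (hD : ∀ i, 1 ≤ i → i ≤ n → i + D i ≤ 2 * n + 1 - i)
    (ℓ : ℕ) (hℓ : ℓ ≤ 2 * n + 1)
    (hDℓ : ∀ i, 1 ≤ i → i ≤ n → ℓ ≤ i + D i ∨ i + D i = 2 * n + 1 - i)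
    (c : ℕ → ℝ) (hc : ∀ k, 0 < c k) :
    ∃ c' : ℕ → ℝ, (∀ k, 0 < c' k) ∧ ∀ i, 1 ≤ i → i ≤ n →
      evalFirst (yv n ℓ) (fBw (n + 1) c (i + 1) (i + D i + 1)) = fBw n c' i (i + D i) := by
  have hadd : ∀ k₀ k, 0 < c (k + 1) + if k = k₀ then c 1 else 0 := by
    intro k₀ k
    have := hc (k + 1)
    have := hc 1
    split_ifs <;> linarith
  by_cases h0 : yv n ℓ = 0
  · refine ⟨fun k => c (k + 1), fun k => hc _, fun i h1 h2 => ?_⟩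
    rw [evalFirst_fBw (by have := hD i h1 h2; omega), h0]
    simp [rootProd]
  have hℓ0 : ℓ ≠ 0 := by rintro rfl; exact h0 (yv_zero n)
  have hℓn : ℓ ≠ n + 1 := by rintro rfl; exact h0 (by simp [yv])
  rcases Nat.lt_or_ge n ℓ with hn | hn
  · refine ⟨_, hadd (2 * n + 2 - ℓ), fun i h1 h2 => ?_⟩
    have h3 := hD i h1 h2
    have h4 := hDℓ i h1 h2
    rw [evalFirst_fBw (by omega), fBw_add_single n (fun k => c (k + 1)) _ _ _ _ (by omega)]
    congr 1
    split_ifs with h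
    · have hy : yv n ℓ = - xv n (2 * n + 2 - ℓ) := by
        unfold yv; rw [if_neg (by omega), if_neg hℓn]
      rw [show i + D i = 2 * n + 1 - i by omega, hy, rootProd_neg h2]
    · rw [rootProd_eq_zero (by omega) (by omega), mul_zero]
  · refine ⟨_, hadd ℓ, fun i h1 h2 => ?_⟩
    have h3 := hD i h1 h2
    have h4 := hDℓ i h1 h2
    rw [evalFirst_fBw (by omega), fBw_add_single n (fun k => c (k + 1)) _ _ _ _ (by omega)]
    congr 1
    split_ifs with h
    · rw [yv, if_pos hn]
    · rw [rootProd_eq_zero (by omega) (by omega), mul_zero]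

theorem prod_alB_enum {n i d : ℕ} {v : ℕ → ℕ}
    (hmem : ∀ t < d, v t ∈ Finset.Icc (i + 1) (i + d))
    (hinj : Set.InjOn v (Finset.range d)) :
    ∏ t ∈ Finset.range d, alB n i (v t) = ∏ ℓ ∈ Finset.Icc (i + 1) (i + d), alB n i ℓ := by
  rw [← Finset.prod_image (f := alB n i) hinj]
  congr 1
  refine Finset.eq_of_subset_of_card_le ?_ ?_
  · intro ℓ hℓ
    obtain ⟨t, ht, rfl⟩ := Finset.mem_image.1 hℓ
    exact hmem t (Finset.mem_range.1 ht)
  · rw [Finset.card_image_of_injOn hinj]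
    simp

theorem koszulBasis_fBw (n : ℕ) (D : ℕ → ℕ)
    (hD : ∀ i, 1 ≤ i → i ≤ n → i + D i ≤ 2 * n + 1 - i)
    (hmono : ∀ i j, 1 ≤ i → i ≤ j → j ≤ n → i + D i ≤ j + D j ∨ j + D j = 2 * n + 1 - j)
    (u : ℕ → ℕ → ℕ)
    (hmem : ∀ i, 1 ≤ i → i ≤ n → ∀ t < D i, u i t ∈ Finset.Icc (i + 1) (i + D i))
    (hinj : ∀ i, 1 ≤ i → i ≤ n → Set.InjOn (u i) (Finset.range (D i)))
    (c : ℕ → ℝ) (hc : ∀ k, 0 < c k) :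
    KoszulBasis (fun i : Fin n => fBw n c (i.val + 1) (i.val + 1 + D (i.val + 1)))
      (fun m : (i : Fin n) → Fin (D (i.val + 1) + 1) =>
        ∏ i : Fin n, ∏ t ∈ Finset.range (m i : ℕ), alB n (i.val + 1) (u (i.val + 1) t)) := by
  induction n generalizing D u c with
  | zero =>
    refine ⟨fun r _ => ⟨fun _ _ => 0, by simp, by simp, fun i => i.elim0⟩, ?_, ?_⟩
    · intro a r h k
      rw [Fintype.sum_eq_single k fun m hm => (hm (Subsingleton.elim _ _)).elim] at h
      simpa [Algebra.smul_def] using h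
    · intro p
      refine ⟨fun _ => constantCoeff p, 0, ?_⟩
      simp [Algebra.smul_def, algebraMap_eq]
      exact eq_C_of_isEmpty p
  | succ n ih =>
    have hD1 := hD 1 le_rfl (by omega)
    let L : ℕ → ℕ := fun t => if t < D 1 then u 1 t - 1 else 0
    have hLmem : ∀ t < D 1, u 1 t = L t + 1 ∧ 1 ≤ L t ∧ L t ≤ D 1 := by
      intro t ht
      have := Finset.mem_Icc.1 (hmem 1 le_rfl (by omega) t ht)
      simp only [L, if_pos ht]
      omega
    have hLle : ∀ t, L t ≤ D 1 := by
      intro t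
      by_cases ht : t < D 1
      · exact (hLmem t ht).2.2
      · simp [L, ht]
    let β : ℕ → MvPolynomial (Fin (n + 1)) ℝ := fun t => X 0 - rename Fin.succ (yv n (L t))
    have hβ : ∀ t < D 1, β t = alB (n + 1) 1 (u 1 t) := by
      intro t ht
      obtain ⟨h1, h2, h3⟩ := hLmem t ht
      rw [h1, alB_eq, xv_one, yv_succ _ _ h2 (by omega)]
    have hβlast : β (D 1) = xv (n + 1) 1 := by
      simp [β, L, yv_zero, xv_one]
    have hD' : ∀ i, 1 ≤ i → i ≤ n → i + D (i + 1) ≤ 2 * n + 1 - i := by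
      intro i h1 h2
      have := hD (i + 1) (by omega) (by omega)
      omega
    have IH : ∀ t, KoszulBasis (fun i : Fin n => evalFirst (yv n (L t))
        (fBw (n + 1) c (i.succ.val + 1) (i.succ.val + 1 + D (i.succ.val + 1))))
        (fun m : (i : Fin n) → Fin (D (i.val + 1 + 1) + 1) => ∏ i : Fin n,
          ∏ t ∈ Finset.range (m i : ℕ), alB n (i.val + 1) (u (i.val + 1 + 1) t - 1)) := by
      intro t
      obtain ⟨c', hc', h⟩ := exists_weights n (fun i => D (i + 1)) hD' (L t)
        (by have := hLle t; omega) (by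
          intro i h1 h2
          have := hmono 1 (i + 1) le_rfl (by omega) (by omega)
          have := hLle t
          have := hD (i + 1) (by omega) (by omega)
          omega) c hc
      have := ih (fun i => D (i + 1)) hD' (by
          intro i j h1 h2 h3
          have := hmono (i + 1) (j + 1) (by omega) (by omega) (by omega)
          omega) (fun i t => u (i + 1) t - 1) (by
          intro i h1 h2 t ht
          have := Finset.mem_Icc.1 (hmem (i + 1) (by omega) (by omega) t ht)
          rw [Finset.mem_Icc]
          omega) (by
          intro i h1 h2 s hs t ht hst
          refine hinj (i + 1) (by omega) (by omega) hs ht ?_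
          have h3 := Finset.mem_Icc.1
            (hmem (i + 1) (by omega) (by omega) s (by simpa using hs))
          have h4 := Finset.mem_Icc.1
            (hmem (i + 1) (by omega) (by omega) t (by simpa using ht))
          dsimp only at hst
          omega) c' hc'
      have hf : (fun i : Fin n => evalFirst (yv n (L t))
          (fBw (n + 1) c (i.succ.val + 1) (i.succ.val + 1 + D (i.succ.val + 1)))) =
          fun i : Fin n => fBw n c' (i.val + 1) (i.val + 1 + D (i.val + 1 + 1)) := by
        funext i
        rw [← h (i.val + 1) (by omega) (by omega), Fin.val_succ,
          add_right_comm (i.val + 1) (D (i.val + 1 + 1)) 1]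
      rw [hf]
      exact this
    have key := KoszulBasis.of_filtration (ι := rename Fin.succ) (β := β)
      (φ := fun t => evalFirst (yv n (L t))) (fun t => X_zero_sub_rename_ne_zero _)
      (fun t a => evalFirst_rename _ a)
      (fun t => by simp only [β, map_sub, evalFirst_X_zero, evalFirst_rename, sub_self])
      (fun t p => dvd_sub_rename_evalFirst _ p)
      (f := fun i : Fin (n + 1) => fBw (n + 1) c (i.val + 1) (i.val + 1 + D (i.val + 1)))
      IH (D 1 + 1) (hc 1).ne' (by
        rw [Finset.prod_range_succ, hβlast,
          Finset.prod_congr rfl fun t ht => hβ t (Finset.mem_range.1 ht),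
          prod_alB_enum (hmem 1 le_rfl (by omega)) (hinj 1 le_rfl (by omega))]
        simp [fBw, rootProd, alB_eq, algebraMap_eq])
    convert key.reindex (Fin.consEquiv (n := n) fun i => Fin (D (i.val + 1) + 1)).symm using 1
    funext m
    rw [Fin.prod_univ_succ]
    simp only [Function.comp_apply, map_prod]
    congr 1
    · refine Finset.prod_congr rfl fun t ht => (hβ t ?_).symm
      have := Finset.mem_range.1 ht
      have := (m 0).2
      simp at this
      omega
    · refine Finset.prod_congr rfl fun i _ => Finset.prod_congr rfl fun t ht => ?_
      have h1 := Finset.mem_range.1 ht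
      have h2 := (m i.succ).2
      simp only [Fin.val_succ] at h2
      have h3 := Finset.mem_Icc.1 (hmem (i.val + 1 + 1) (by omega) (by omega) t (by omega))
      have h4 := hD (i.val + 1 + 1) (by omega) (by omega)
      rw [alB_eq, alB_eq, map_sub, ← xv_succ_s4 _ _ (by omega), ← yv_succ _ _ (by omega) (by omega)]
      simp only [Fin.val_succ]
      congr 2
      omega

/-- **Theorem 5.7 (type B).** For a Hessenberg function `h` of type `B_n` and any choice of
permutations `w⁽ⁱ⁾` of `{i+1,…,h(i)}`, the classes
`∏_{i=1}^{n} α^{B}_{i,w⁽ⁱ⁾(h(i))}···α^{B}_{i,w⁽ⁱ⁾(h(i)−m_i+1)}`, `0 ≤ m_i ≤ h(i)−i`, form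
an ℝ-basis of `H^*(Hess(N,h)) ≅ R^{B}_h`. -/
theorem stmt_4 (n : ℕ) (hn : 1 ≤ n) (h : ℕ → ℕ)
    (hh1 : ∀ i ∈ Finset.Icc 1 n, i ≤ h i ∧ h i ≤ 2 * n + 1 - i)
    (hh2 : ∀ i ∈ Finset.Icc 1 (n - 1), h i ≠ 2 * n + 1 - i → h i ≤ h (i + 1))
    (hh3 : ∀ i ∈ Finset.Icc 1 (n - 1), h i = 2 * n + 1 - i → h (i + 1) = 2 * n + 1 - (i + 1))
    (w : ℕ → Equiv.Perm ℕ)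
    (hw : ∀ i ∈ Finset.Icc 1 n, ∀ j ∈ Finset.Icc (i + 1) (h i),
      w i j ∈ Finset.Icc (i + 1) (h i)) :
    LinearIndependent ℝ (basBh n h w) ∧
      Submodule.span ℝ (Set.range (basBh n h w)) = ⊤ := by
  have hmono : ∀ i j, 1 ≤ i → i ≤ j → j ≤ n → h i ≤ h j ∨ h j = 2 * n + 1 - j := by
    intro i j h1 h2
    induction j, h2 using Nat.le_induction with
    | base => exact fun _ => Or.inl le_rfl
    | succ j hij ih =>
      intro hj
      have hj' : j ∈ Finset.Icc 1 (n - 1) := Finset.mem_Icc.2 (by omega)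
      have := hh2 j hj'
      have := hh3 j hj'
      have := ih (by omega)
      omega
  have hadd : ∀ i, 1 ≤ i → i ≤ n → i + (h i - i) = h i := by
    intro i h1 h2
    have := hh1 i (Finset.mem_Icc.2 ⟨h1, h2⟩)
    omega
  have key := koszulBasis_fBw n (fun i => h i - i)
    (fun i h1 h2 => by
      have := hh1 i (Finset.mem_Icc.2 ⟨h1, h2⟩)
      omega)
    (fun i j h1 h2 h3 => by
      rw [hadd i h1 (by omega), hadd j (by omega) h3]
      exact hmono i j h1 h2 h3)
    (fun i t => w i (h i - t))
    (fun i h1 h2 t ht => by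
      rw [hadd i h1 h2]
      exact hw i (Finset.mem_Icc.2 ⟨h1, h2⟩) _ (Finset.mem_Icc.2 (by omega)))
    (fun i h1 h2 s hs t ht hst => by
      have := (w i).injective hst
      simp only [Finset.coe_range, Set.mem_Iio] at hs ht
      omega)
    1 (fun _ => one_pos)
  simp only [fBw_one] at key
  have hI : IBh n h = Ideal.span (Set.range fun i : Fin n =>
      fBij n (i.val + 1) (i.val + 1 + (h (i.val + 1) - (i.val + 1)))) := by
    unfold IBh
    congr 1
    ext p
    constructor
    · rintro ⟨i, hi, rfl⟩
      obtain ⟨h1, h2⟩ := hi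
      refine ⟨⟨i - 1, by omega⟩, ?_⟩
      simp only [Nat.sub_add_cancel h1, hadd i h1 h2]
    · rintro ⟨i, rfl⟩
      refine ⟨i.val + 1, ⟨by omega, by omega⟩, ?_⟩
      simp only [hadd (i.val + 1) (by omega) (by omega)]
  constructor
  · rw [Fintype.linearIndependent_iff]
    intro a ha
    have h0 : Ideal.Quotient.mkₐ ℝ (IBh n h) (∑ m, a m • ∏ i : Fin n,
        ∏ t ∈ Finset.range (m i : ℕ),
          alB n (i.val + 1) (w (i.val + 1) (h (i.val + 1) - t))) = 0 := by
      rw [← ha, map_sum]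
      simp only [map_smul]
      rfl
    have h1 := Ideal.Quotient.eq_zero_iff_mem.1 h0
    rw [hI, Ideal.mem_span_range_iff_exists_fun] at h1
    obtain ⟨r, hr⟩ := h1
    exact key.indep a r hr.symm
  · rw [eq_top_iff]
    rintro q -
    obtain ⟨p, rfl⟩ := Ideal.Quotient.mk_surjective q
    obtain ⟨a, r, hp⟩ := key.spans p
    have h1 : Ideal.Quotient.mk (IBh n h) p = ∑ m, a m • basBh n h w m := by
      have h2 : p - ∑ m, a m • ∏ i : Fin n, ∏ t ∈ Finset.range (m i : ℕ),
          alB n (i.val + 1) (w (i.val + 1) (h (i.val + 1) - t)) ∈ IBh n h := by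
        rw [hI, Ideal.mem_span_range_iff_exists_fun]
        exact ⟨r, by rw [hp]; ring⟩
      rw [(Ideal.Quotient.mk_eq_mk_iff_sub_mem _ _).2 h2]
      change Ideal.Quotient.mkₐ ℝ (IBh n h) _ = _
      rw [map_sum]
      simp only [map_smul]
      rfl
    rw [h1]
    exact Submodule.sum_mem _ fun m _ =>
      Submodule.smul_mem _ _ (Submodule.subset_span ⟨m, rfl⟩)
end
end
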